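/- arXiv:1502.05205 — 3 statements merged into one kernel-verified Lean document; each statement's English description precedes it below -/
import Mathlib

section
/- Criticality of the Filippas–Tertikas–Tidblom operator when α_n = 0 (Theorem 7.2): let n ≥ 2, let α₁, …, α_n be nonpositive real numbers with α_n = 0, define β₁ := 1/4 − α₁² and β_i := (α_{i−1} − 1/2)² − α_i² for 2 ≤ i ≤ n, and set V(x) := β₁/x₁² + β₂/(x₁² + x₂²) + ⋯ + β_n/(x₁² + ⋯ + x_n²). Assume that α₁, …, α_{n−1} are either pairwise distinct or all strictly negative. Then the operator −Δ − V is critical in ℝⁿ₊: for every measurable function W : ℝⁿ₊ → [0, ∞] that is strictly positive on a set of positive Lebesgue measure, there exists φ ∈ C_c^∞(ℝⁿ₊) with ∫_{ℝⁿ₊} |∇φ|² dx < ∫_{ℝⁿ₊} (V + W) φ² dx; i.e., the Hardy inequality ∫|∇φ|² ≥ ∫ V φ² cannot be improved by adding any nonnegative nontrivial weight to V. -/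
open MeasureTheory
open scoped ENNReal

noncomputable section

/-- Test functions: smooth compactly supported functions with support in `Ω`. -/
def IsTestFun {n : ℕ} (Ω : Set (EuclideanSpace ℝ (Fin n)))
    (φ : EuclideanSpace ℝ (Fin n) → ℝ) : Prop :=
  ContDiff ℝ (⊤ : ℕ∞) φ ∧ HasCompactSupport φ ∧ tsupport φ ⊆ Ω

/-- The open half-space `{x ∈ ℝⁿ : x₁ > 0}`. -/
def Hplus (n : ℕ) [NeZero n] : Set (EuclideanSpace ℝ (Fin n)) := {x | 0 < x 0}


/-! ### Part 1: integration of the weight -/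

def Qs {m : ℕ} (i : ℕ) (x : Fin m → ℝ) : ℝ := ∑ j : Fin m, if (j : ℕ) ≤ i then x j ^ 2 else 0

def cc (a : ℕ → ℝ) : ℕ → ℝ
  | 0 => 1 / 2 - a 0
  | k + 1 => a k - a (k + 1) - 1 / 2

def goodSet (m i : ℕ) (A : ℝ) : Set (Fin (m + 1) → ℝ) :=
  {x | 0 < x 0 ∧ ∀ j ≤ m, i < j → |Real.log (Qs j x)| ≤ A}

def wt (a : ℕ → ℝ) (m i : ℕ) (A : ℝ) : (Fin (m + 1) → ℝ) → ℝ≥0∞ :=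
  (goodSet m i A).indicator
    (fun x => ENNReal.ofReal (∏ j ∈ Finset.range (m + 1), Qs j x ^ cc a j))

lemma measurable_Qs {m : ℕ} (i : ℕ) : Measurable (Qs i : (Fin m → ℝ) → ℝ) := by
  unfold Qs
  refine Finset.measurable_sum _ fun j _ => ?_
  split_ifs
  · exact (measurable_pi_apply j).pow_const 2
  · exact measurable_const

lemma measurableSet_goodSet (m i : ℕ) (A : ℝ) : MeasurableSet (goodSet m i A) := by
  have : goodSet m i A = {x | 0 < x 0} ∩ ⋂ j : ℕ, {x | j ≤ m → i < j → |Real.log (Qs j x)| ≤ A} := by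
    ext x; simp [goodSet]
  rw [this]
  refine (measurableSet_lt measurable_const (measurable_pi_apply 0)).inter
    (MeasurableSet.iInter fun j => ?_)
  by_cases h1 : j ≤ m
  · by_cases h2 : i < j
    · simp only [h1, h2, true_imp_iff]
      have hm := (Real.measurable_log.comp (measurable_Qs (m := m + 1) j))
      exact measurableSet_le (f := fun x => |Real.log (Qs j x)|) (hm.norm) measurable_const
    · simp [h2]
  · simp [h1]

lemma measurable_wt (a : ℕ → ℝ) (m i : ℕ) (A : ℝ) : Measurable (wt a m i A) := by
  refine Measurable.indicator ?_ (measurableSet_goodSet m i A)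
  refine ENNReal.measurable_ofReal.comp ?_
  exact Finset.measurable_prod _ fun j _ => (measurable_Qs j).pow_const _

lemma measurable_wtg (a : ℕ → ℝ) (m i : ℕ) (A : ℝ) (g : ℝ → ℝ≥0∞) (hg : Measurable g) :
    Measurable (fun x => wt a m i A x * g (Qs i x)) :=
  (measurable_wt a m i A).mul (hg.comp (measurable_Qs i))

lemma Qs_snoc {m : ℕ} (i : ℕ) (y : Fin m → ℝ) (t : ℝ) :
    Qs i (Fin.snoc y t : Fin (m + 1) → ℝ) = Qs i y + if m ≤ i then t ^ 2 else 0 := by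
  unfold Qs
  rw [Fin.sum_univ_castSucc]
  simp

lemma Qs_ge {m : ℕ} {i : ℕ} (h : m ≤ i) (y : Fin (m + 1) → ℝ) : Qs i y = Qs m y := by
  unfold Qs
  refine Finset.sum_congr rfl fun j _ => ?_
  have := j.2
  rw [if_pos (by omega), if_pos (by omega)]

lemma Qs_nonneg {m : ℕ} (i : ℕ) (y : Fin m → ℝ) : 0 ≤ Qs i y :=
  Finset.sum_nonneg fun j _ => by split_ifs <;> positivity

lemma Qs_mono {m : ℕ} {i k : ℕ} (h : i ≤ k) (y : Fin m → ℝ) : Qs i y ≤ Qs k y := by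
  refine Finset.sum_le_sum fun j _ => ?_
  split_ifs with h1 h2 h2
  · rfl
  · omega
  · positivity
  · rfl

lemma Qs_pos {m : ℕ} (i : ℕ) (y : Fin (m + 1) → ℝ) (hy : 0 < y 0) : 0 < Qs i y := by
  refine Finset.sum_pos' (fun j _ => by split_ifs <;> positivity) ⟨0, Finset.mem_univ _, ?_⟩
  simp; positivity

lemma lintegral_snoc {m : ℕ} (f : (Fin (m + 1) → ℝ) → ℝ≥0∞) (hf : Measurable f) :
    ∫⁻ x, f x = ∫⁻ t : ℝ, ∫⁻ y : Fin m → ℝ, f (Fin.snoc y t : Fin (m + 1) → ℝ) := by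
  have h := (volume_preserving_piFinSuccAbove (fun _ : Fin (m + 1) => ℝ) (Fin.last m)).symm
  rw [← h.lintegral_comp hf, Measure.volume_eq_prod, lintegral_prod]
  · simp [MeasurableEquiv.piFinSuccAbove_symm_apply, Fin.insertNthEquiv, Fin.insertNth_last']
  · exact (hf.comp (MeasurableEquiv.measurable _)).aemeasurable

lemma measurable_snoc2 {m : ℕ} :
    Measurable (fun p : ℝ × (Fin m → ℝ) => (Fin.snoc p.2 p.1 : Fin (m + 1) → ℝ)) := by
  have := (MeasurableEquiv.piFinSuccAbove (fun _ : Fin (m + 1) => ℝ) (Fin.last m)).symm.measurable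
  convert this using 2 with p
  simp [MeasurableEquiv.piFinSuccAbove_symm_apply, Fin.insertNthEquiv, Fin.insertNth_last']

lemma polar_bound (p c : ℝ) (hp : 0 ≤ p) (g : ℝ → ℝ≥0∞) (hg : Measurable g) :
    ∫⁻ t : ℝ, ∫⁻ r in Set.Ioi (0 : ℝ), ENNReal.ofReal (r ^ p) *
        (ENNReal.ofReal ((r ^ 2 + t ^ 2) ^ c) * g (r ^ 2 + t ^ 2))
      ≤ ENNReal.ofReal (2 * Real.pi) *
        ∫⁻ r in Set.Ioi (0 : ℝ), ENNReal.ofReal (r ^ (p + 2 * c + 1)) * g (r ^ 2) := by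
  set G : ℝ × ℝ → ℝ≥0∞ := fun q => (Set.Ioi (0 : ℝ)).indicator (fun _ => 1) q.1 *
    (ENNReal.ofReal (q.1 ^ p) *
        (ENNReal.ofReal ((q.1 ^ 2 + q.2 ^ 2) ^ c) * g (q.1 ^ 2 + q.2 ^ 2))) with hG
  have hGm : Measurable G := by
    have h1 : Measurable (fun q : ℝ × ℝ => (Set.Ioi (0 : ℝ)).indicator (fun _ => (1 : ℝ≥0∞)) q.1) :=
      (measurable_const.indicator measurableSet_Ioi).comp measurable_fst
    have h2 : Measurable (fun q : ℝ × ℝ => q.1 ^ 2 + q.2 ^ 2) := by fun_prop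
    exact h1.mul ((ENNReal.measurable_ofReal.comp (measurable_fst.pow_const p)).mul
      ((ENNReal.measurable_ofReal.comp (h2.pow_const c)).mul (hg.comp h2)))
  have e1 : ∫⁻ t : ℝ, ∫⁻ r in Set.Ioi (0 : ℝ), ENNReal.ofReal (r ^ p) *
        (ENNReal.ofReal ((r ^ 2 + t ^ 2) ^ c) * g (r ^ 2 + t ^ 2)) = ∫⁻ q, G q := by
    rw [Measure.volume_eq_prod, lintegral_prod_symm _ hGm.aemeasurable]
    refine lintegral_congr fun t => ?_
    rw [← lintegral_indicator measurableSet_Ioi]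
    refine lintegral_congr fun r => ?_
    by_cases hr : r ∈ Set.Ioi (0 : ℝ) <;> simp [hG, hr]
  rw [e1, ← lintegral_comp_polarCoord_symm]
  have e2 : ∀ q ∈ polarCoord.target, ENNReal.ofReal q.1 • G (polarCoord.symm q) ≤
      (ENNReal.ofReal (q.1 ^ (p + 2 * c + 1)) * g (q.1 ^ 2)) * 1 := by
    rintro ⟨r, θ⟩ hq
    have hr : 0 < r := by
      simp [polarCoord] at hq; exact hq.1
    simp only [polarCoord_symm_apply, hG, smul_eq_mul, mul_one]
    have e3 : (r * Real.cos θ) ^ 2 + (r * Real.sin θ) ^ 2 = r ^ 2 := by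
      have := Real.cos_sq_add_sin_sq θ
      calc _ = r ^ 2 * (Real.cos θ ^ 2 + Real.sin θ ^ 2) := by ring
        _ = _ := by rw [this, mul_one]
    rw [e3]
    by_cases hc : 0 < r * Real.cos θ
    · rw [Set.indicator_of_mem (by exact hc), one_mul, ← mul_assoc, ← mul_assoc]
      gcongr
      rw [← ENNReal.ofReal_mul hr.le, ← ENNReal.ofReal_mul (by positivity)]
      apply ENNReal.ofReal_le_ofReal
      have h1 : (r * Real.cos θ) ^ p ≤ r ^ p := by
        apply Real.rpow_le_rpow hc.le _ hp
        nlinarith [Real.cos_le_one θ]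
      have h2 : (r ^ 2) ^ c = r ^ (2 * c) := by
        rw [← Real.rpow_natCast, ← Real.rpow_mul hr.le]; norm_num
      rw [h2, Real.rpow_add hr, Real.rpow_add hr, Real.rpow_one]
      have h3 : 0 < r ^ (2 * c) := by positivity
      calc r * (r * Real.cos θ) ^ p * r ^ (2 * c) ≤ r * r ^ p * r ^ (2 * c) := by gcongr
        _ = _ := by ring
    · rw [Set.indicator_of_notMem (by exact hc)]
      simp
  calc _ ≤ ∫⁻ q in polarCoord.target, (ENNReal.ofReal (q.1 ^ (p + 2 * c + 1)) * g (q.1 ^ 2)) * 1 :=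
        setLIntegral_mono' polarCoord.open_target.measurableSet e2
    _ = (∫⁻ r in Set.Ioi (0 : ℝ), ENNReal.ofReal (r ^ (p + 2 * c + 1)) * g (r ^ 2)) *
          ∫⁻ θ in Set.Ioo (-Real.pi) Real.pi, 1 := by
        rw [show polarCoord.target = Set.Ioi (0 : ℝ) ×ˢ Set.Ioo (-Real.pi) Real.pi from rfl,
          Measure.volume_eq_prod, ← Measure.prod_restrict]
        refine lintegral_prod_mul (f := fun r : ℝ => ENNReal.ofReal (r ^ (p + 2 * c + 1)) * g (r ^ 2))
          (g := fun _ : ℝ => 1) ?_ aemeasurable_const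
        exact ((ENNReal.measurable_ofReal.comp (measurable_id.pow_const _)).mul
          (hg.comp (measurable_id.pow_const 2))).aemeasurable
    _ = _ := by
        rw [mul_comm, setLIntegral_one, Real.volume_Ioo]
        congr 2; ring
    _ ≤ _ := le_rfl

lemma rpow_le_of_log {s c A : ℝ} (hs : 0 < s) (h : |Real.log s| ≤ A) :
    s ^ c ≤ Real.exp (|c| * A) := by
  rw [Real.rpow_def_of_pos hs]
  apply Real.exp_le_exp.2
  calc Real.log s * c ≤ |Real.log s * c| := le_abs_self _
    _ = |c| * |Real.log s| := by rw [abs_mul, mul_comm]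
    _ ≤ _ := by gcongr

lemma key_bound (a : ℕ → ℝ) (ha : ∀ i, a i ≤ 0) (A : ℝ) (m : ℕ) : ∀ i ≤ m, ∃ C : ℝ≥0∞, C ≠ ⊤ ∧
    ∀ g : ℝ → ℝ≥0∞, Measurable g → ∫⁻ x : Fin (m + 1) → ℝ, wt a m i A x * g (Qs i x) ≤
      C * ∫⁻ r in Set.Ioi (0 : ℝ), ENNReal.ofReal (r ^ (1 - 2 * a i)) * g (r ^ 2) := by
  induction m with
  | zero =>
    intro i hi
    obtain rfl : i = 0 := by omega
    refine ⟨1, by simp, fun g hg => ?_⟩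
    rw [one_mul]
    have h := (volume_preserving_funUnique (Fin 1) ℝ).symm
    refine (h.lintegral_comp (measurable_wtg a 0 0 A g hg)).symm.le.trans ?_
    rw [← lintegral_indicator measurableSet_Ioi]
    refine lintegral_mono fun r => ?_
    by_cases hr : 0 < r
    · rw [Set.indicator_of_mem (by exact hr)]
      have h2 : (r ^ 2) ^ (1 / 2 - a 0) = r ^ (1 - 2 * a 0) := by
        rw [← Real.rpow_natCast, ← Real.rpow_mul hr.le]; congr 1; push_cast; ring
      have hmem : ((MeasurableEquiv.funUnique (Fin 1) ℝ).symm r) ∈ goodSet 0 0 A := by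
        simp [goodSet, MeasurableEquiv.funUnique, hr]
      simp only [wt]
      rw [Set.indicator_of_mem hmem]
      simp at h2
      simp [Qs, MeasurableEquiv.funUnique, cc, h2]
    · have : ((MeasurableEquiv.funUnique (Fin 1) ℝ).symm r) ∉ goodSet 0 0 A := by
        simp [goodSet, MeasurableEquiv.funUnique, hr]
      simp only [wt]
      rw [Set.indicator_of_notMem this]; simp
  | succ m ih =>
    intro i hi
    rcases Nat.lt_or_ge m i with hmi | him
    · obtain rfl : i = m + 1 := by omega
      obtain ⟨C, hC, hb⟩ := ih m le_rfl
      refine ⟨C * ENNReal.ofReal (2 * Real.pi), ENNReal.mul_ne_top hC ENNReal.ofReal_ne_top,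
        fun g hg => ?_⟩
      rw [lintegral_snoc _ (measurable_wtg _ _ _ _ g hg)]
      have step : ∀ t : ℝ, ∫⁻ y : Fin (m + 1) → ℝ, wt a (m + 1) (m + 1) A (Fin.snoc y t) *
          g (Qs (m + 1) (Fin.snoc y t : Fin (m + 2) → ℝ)) ≤
          C * ∫⁻ r in Set.Ioi (0 : ℝ), ENNReal.ofReal (r ^ (1 - 2 * a m)) *
            (ENNReal.ofReal ((r ^ 2 + t ^ 2) ^ cc a (m + 1)) * g (r ^ 2 + t ^ 2)) := by
        intro t
        have hgt : Measurable fun s : ℝ => ENNReal.ofReal ((s + t ^ 2) ^ cc a (m + 1)) *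
            g (s + t ^ 2) := by
          have h2 : Measurable fun s : ℝ => s + t ^ 2 := by fun_prop
          exact (ENNReal.measurable_ofReal.comp (h2.pow_const _)).mul (hg.comp h2)
        refine le_trans (lintegral_mono fun y => ?_) (hb _ hgt)
        have hQ : Qs (m + 1) (Fin.snoc y t : Fin (m + 2) → ℝ) = Qs m y + t ^ 2 := by
          rw [Qs_snoc, if_pos le_rfl, Qs_ge (Nat.le_succ m)]
        by_cases hy : (Fin.snoc y t : Fin (m + 2) → ℝ) ∈ goodSet (m + 1) (m + 1) A
        · have hy0 : 0 < y 0 := by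
            have := hy.1
            rwa [← Fin.castSucc_zero, Fin.snoc_castSucc] at this
          have hy' : y ∈ goodSet m m A := ⟨hy0, fun j h1 h2 => by omega⟩
          simp only [wt]
          rw [Set.indicator_of_mem hy, Set.indicator_of_mem hy', Finset.prod_range_succ, hQ,
            ENNReal.ofReal_mul (Finset.prod_nonneg fun j _ => Real.rpow_nonneg (Qs_nonneg _ _) _),
            mul_assoc]
          apply le_of_eq
          congr 2
          refine Finset.prod_congr rfl fun j hj => ?_
          rw [Qs_snoc, if_neg (by simp at hj; omega), add_zero]
        · simp only [wt]
          rw [Set.indicator_of_notMem hy]; simp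
      refine (lintegral_mono step).trans ?_
      rw [lintegral_const_mul' _ _ hC, mul_assoc]
      gcongr
      have := polar_bound (1 - 2 * a m) (cc a (m + 1)) (by linarith [ha m]) g hg
      have e : 1 - 2 * a m + 2 * cc a (m + 1) + 1 = 1 - 2 * a (m + 1) := by
        simp only [cc]; ring
      rw [e] at this
      exact this
    · obtain ⟨C, hC, hb⟩ := ih i him
      set K := Real.exp (|cc a (m + 1)| * A)
      set B := Real.exp (A / 2)
      refine ⟨C * (ENNReal.ofReal K * ENNReal.ofReal (2 * B)), ENNReal.mul_ne_top hC
        (ENNReal.mul_ne_top ENNReal.ofReal_ne_top ENNReal.ofReal_ne_top), fun g hg => ?_⟩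
      rw [lintegral_snoc _ (measurable_wtg _ _ _ _ g hg)]
      set I := ∫⁻ r in Set.Ioi (0 : ℝ), ENNReal.ofReal (r ^ (1 - 2 * a i)) * g (r ^ 2)
      have step : ∀ t : ℝ, ∫⁻ y : Fin (m + 1) → ℝ, wt a (m + 1) i A (Fin.snoc y t) *
          g (Qs i (Fin.snoc y t : Fin (m + 2) → ℝ)) ≤
          (Set.Icc (-B) B).indicator (fun _ => ENNReal.ofReal K * (C * I)) t := by
        intro t
        have pt : ∀ y : Fin (m + 1) → ℝ, wt a (m + 1) i A (Fin.snoc y t) *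
            g (Qs i (Fin.snoc y t : Fin (m + 2) → ℝ)) ≤
            (Set.Icc (-B) B).indicator (fun _ => ENNReal.ofReal K) t *
              (wt a m i A y * g (Qs i y)) := by
          intro y
          by_cases hy : (Fin.snoc y t : Fin (m + 2) → ℝ) ∈ goodSet (m + 1) i A
          · have hy0 : 0 < y 0 := by
              have := hy.1
              rwa [← Fin.castSucc_zero, Fin.snoc_castSucc] at this
            have hlast := hy.2 (m + 1) le_rfl (by omega)
            have hp : 0 < Qs (m + 1) (Fin.snoc y t : Fin (m + 2) → ℝ) := Qs_pos _ _ hy.1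
            have ht : t ∈ Set.Icc (-B) B := by
              rw [Set.mem_Icc, ← abs_le]
              have h1 : t ^ 2 ≤ Qs (m + 1) (Fin.snoc y t : Fin (m + 2) → ℝ) := by
                rw [Qs_snoc, if_pos le_rfl]; linarith [Qs_nonneg (m + 1) y]
              have h2 : Qs (m + 1) (Fin.snoc y t : Fin (m + 2) → ℝ) ≤ B ^ 2 := by
                have : B ^ 2 = Real.exp A := by
                  rw [← Real.exp_nat_mul]; congr 1; push_cast; ring
                rw [this, ← Real.log_le_iff_le_exp hp]
                exact (le_abs_self _).trans hlast
              exact abs_le_of_sq_le_sq (h1.trans h2) (Real.exp_pos _).le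
            have hy' : y ∈ goodSet m i A := ⟨hy0, fun j h1 h2 => by
              have := hy.2 j (by omega) h2
              rwa [Qs_snoc, if_neg (by omega), add_zero] at this⟩
            simp only [wt]
            rw [Set.indicator_of_mem hy, Set.indicator_of_mem hy', Set.indicator_of_mem ht,
              Finset.prod_range_succ,
              ENNReal.ofReal_mul (Finset.prod_nonneg fun j _ => Real.rpow_nonneg (Qs_nonneg _ _) _)]
            have e1 : ∏ j ∈ Finset.range (m + 1), Qs j (Fin.snoc y t : Fin (m + 2) → ℝ) ^ cc a j =
                ∏ j ∈ Finset.range (m + 1), Qs j y ^ cc a j := by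
              refine Finset.prod_congr rfl fun j hj => ?_
              rw [Qs_snoc, if_neg (by simp at hj; omega), add_zero]
            have e2 : Qs i (Fin.snoc y t : Fin (m + 2) → ℝ) = Qs i y := by
              rw [Qs_snoc, if_neg (by omega), add_zero]
            rw [e1, e2, ← mul_assoc, mul_comm (ENNReal.ofReal K)]
            gcongr
            exact rpow_le_of_log hp hlast
          · simp only [wt]
            rw [Set.indicator_of_notMem hy]; simp
        refine (lintegral_mono pt).trans ?_
        rw [lintegral_const_mul _ (measurable_wtg _ _ _ _ g hg)]
        by_cases ht : t ∈ Set.Icc (-B) B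
        · rw [Set.indicator_of_mem ht, Set.indicator_of_mem ht]
          gcongr
          exact hb g hg
        · rw [Set.indicator_of_notMem ht, Set.indicator_of_notMem ht]; simp
      refine (lintegral_mono step).trans ?_
      rw [lintegral_indicator measurableSet_Icc, setLIntegral_const, Real.volume_Icc]
      apply le_of_eq
      rw [show B - -B = 2 * B by ring]
      ring

/-! ### Part 2: the ground state identity -/

abbrev EE (m : ℕ) := EuclideanSpace ℝ (Fin (m + 1))

def pv {m : ℕ} (i : ℕ) (x : EE m) : EE m :=
  WithLp.toLp 2 (fun j : Fin (m + 1) => if (j : ℕ) ≤ i then x j else 0)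

def RR {m : ℕ} (i : ℕ) (x : EE m) : ℝ := Qs i x.ofLp

def HH (m : ℕ) : Set (EE m) := {x | 0 < x 0}

lemma isOpen_HH (m : ℕ) : IsOpen (HH m) := by
  have : Continuous fun x : EE m => x 0 := by fun_prop
  exact isOpen_lt continuous_const this

lemma RR_pos {m : ℕ} (i : ℕ) {x : EE m} (hx : x ∈ HH m) : 0 < RR i x := Qs_pos i _ hx

lemma contDiff_RR {m : ℕ} (i : ℕ) : ContDiff ℝ (⊤ : ℕ∞) (RR i : EE m → ℝ) := by
  unfold RR Qs
  refine ContDiff.sum fun j _ => ?_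
  split_ifs
  · fun_prop
  · exact contDiff_const

lemma hasFDerivAt_RR {m : ℕ} (i : ℕ) (x : EE m) :
    HasFDerivAt (RR i : EE m → ℝ) ((2 : ℝ) • innerSL ℝ (pv i x)) x := by
  have h : ∀ j ∈ (Finset.univ : Finset (Fin (m + 1))),
      HasFDerivAt (fun y : EE m => if (j : ℕ) ≤ i then y j ^ 2 else 0)
      (if (j : ℕ) ≤ i then (2 * x j) • (EuclideanSpace.proj j : EE m →L[ℝ] ℝ) else 0) x := by
    intro j _
    split_ifs
    · have h1 : HasFDerivAt (fun y : EE m => y j) (EuclideanSpace.proj j : EE m →L[ℝ] ℝ) x :=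
        (EuclideanSpace.proj j : EE m →L[ℝ] ℝ).hasFDerivAt
      have := h1.pow 2
      simpa using this
    · exact hasFDerivAt_const _ _
  have h2 := HasFDerivAt.fun_sum h
  refine h2.congr_fderiv ?_
  ext v
  simp only [sum_apply, smul_apply, innerSL_apply_apply,
    PiLp.inner_apply, pv, smul_eq_mul, Finset.mul_sum]
  refine Finset.sum_congr rfl fun j _ => ?_
  split_ifs <;> simp
  ring

lemma inner_pv {m : ℕ} (i k : ℕ) (x : EE m) : inner ℝ (pv i x) (pv k x) = RR (min i k) x := by
  simp only [PiLp.inner_apply, pv, RR, Qs]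
  refine Finset.sum_congr rfl fun j _ => ?_
  by_cases h1 : (j : ℕ) ≤ i <;> by_cases h2 : (j : ℕ) ≤ k <;> simp [h1, h2, sq]

lemma norm_pv_sq {m : ℕ} (i : ℕ) (x : EE m) : ‖pv i x‖ ^ 2 = RR i x := by
  rw [← real_inner_self_eq_norm_sq, inner_pv, min_self]

def FF {m : ℕ} (c : ℕ → ℝ) (x : EE m) : EE m :=
  ∑ i ∈ Finset.range (m + 1), (c i / RR i x) • pv i x

lemma FF_apply {m : ℕ} (c : ℕ → ℝ) (x : EE m) (j : Fin (m + 1)) :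
    FF c x j = ∑ i ∈ Finset.range (m + 1), (c i / RR i x) * (pv i x j) := by
  simp [FF]

lemma contDiff_pv {m : ℕ} (i : ℕ) (j : Fin (m + 1)) :
    ContDiff ℝ (⊤ : ℕ∞) (fun x : EE m => pv i x j) := by
  simp only [pv]
  split_ifs
  · fun_prop
  · exact contDiff_const

lemma contDiffOn_FF {m : ℕ} (c : ℕ → ℝ) (j : Fin (m + 1)) :
    ContDiffOn ℝ (⊤ : ℕ∞) (fun x : EE m => FF c x j) (HH m) := by
  simp only [FF_apply]
  refine ContDiffOn.sum fun i _ => ?_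
  refine ContDiffOn.mul (contDiffOn_const.div (contDiff_RR i).contDiffOn ?_) (contDiff_pv i j).contDiffOn
  intro x hx
  exact (RR_pos i hx).ne'

lemma norm_FF_sq {m : ℕ} (c : ℕ → ℝ) (x : EE m) (hx : x ∈ HH m) :
    ‖FF c x‖ ^ 2 = ∑ i ∈ Finset.range (m + 1),
      (c i ^ 2 + 2 * c i * ∑ k ∈ Finset.range i, c k) / RR i x := by
  unfold FF
  have : ∀ N : ℕ, ‖∑ i ∈ Finset.range N, (c i / RR i x) • pv i x‖ ^ 2 =
      ∑ i ∈ Finset.range N, (c i ^ 2 + 2 * c i * ∑ k ∈ Finset.range i, c k) / RR i x := by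
    intro N
    induction N with
    | zero => simp
    | succ N ih =>
      have hN := (RR_pos N hx).ne'
      rw [Finset.sum_range_succ, Finset.sum_range_succ, norm_add_sq_real, ih, norm_smul, mul_pow,
        norm_pv_sq, sum_inner]
      have : ∀ k ∈ Finset.range N, inner ℝ ((c k / RR k x) • pv k x) ((c N / RR N x) • pv N x) =
          c N / RR N x * c k := by
        intro k hk
        have hk' := (RR_pos k hx).ne'
        rw [real_inner_smul_left, real_inner_smul_right, inner_pv,
          min_eq_left (by simp at hk; omega)]
        field_simp
      rw [Finset.sum_congr rfl this, ← Finset.mul_sum, Real.norm_eq_abs, sq_abs]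
      field_simp
      ring
  exact this _

lemma hasFDerivAt_FF {m : ℕ} (c : ℕ → ℝ) (x : EE m) (hx : x ∈ HH m) (j : Fin (m + 1)) :
    ∃ f' : EE m →L[ℝ] ℝ, HasFDerivAt (fun x : EE m => FF c x j) f' x ∧
      f' (EuclideanSpace.single j 1) = ∑ i ∈ Finset.range (m + 1),
        ((if (j : ℕ) ≤ i then c i / RR i x else 0) - 2 * c i / RR i x ^ 2 * (pv i x j) ^ 2) := by
  simp only [FF_apply]
  have h : ∀ i ∈ Finset.range (m + 1), HasFDerivAt (fun x : EE m => (c i / RR i x) * (pv i x j))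
      ((c i / RR i x) • (if (j : ℕ) ≤ i then (EuclideanSpace.proj j : EE m →L[ℝ] ℝ) else 0) +
        (pv i x j) • (c i • -((RR i x ^ 2)⁻¹) • ((2 : ℝ) • innerSL ℝ (pv i x)))) x := by
    intro i _
    have h1 : HasFDerivAt (fun x : EE m => pv i x j)
        (if (j : ℕ) ≤ i then (EuclideanSpace.proj j : EE m →L[ℝ] ℝ) else 0) x := by
      simp only [pv]
      split_ifs
      · exact (EuclideanSpace.proj j : EE m →L[ℝ] ℝ).hasFDerivAt
      · exact hasFDerivAt_const _ _
    have h2 : HasFDerivAt (fun x : EE m => c i / RR i x)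
        (c i • -((RR i x ^ 2)⁻¹) • ((2 : ℝ) • innerSL ℝ (pv i x))) x := by
      simp only [div_eq_mul_inv]
      have := ((hasDerivAt_inv (RR_pos i hx).ne').comp_hasFDerivAt x (hasFDerivAt_RR i x)).const_mul (c i)
      exact this
    exact h2.mul h1
  refine ⟨_, HasFDerivAt.fun_sum h, ?_⟩
  rw [sum_apply]
  refine Finset.sum_congr rfl fun i _ => ?_
  have h3 : inner ℝ (pv i x) (EuclideanSpace.single j (1 : ℝ)) = pv i x j := by
    rw [EuclideanSpace.inner_single_right]; simp
  split_ifs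
  · simp [h3]; ring
  · simp [h3]; ring

lemma sum_div_FF {m : ℕ} (c : ℕ → ℝ) (x : EE m) (hx : x ∈ HH m) :
    ∑ j : Fin (m + 1), ∑ i ∈ Finset.range (m + 1),
        ((if (j : ℕ) ≤ i then c i / RR i x else 0) - 2 * c i / RR i x ^ 2 * (pv i x j) ^ 2) =
    ∑ i ∈ Finset.range (m + 1), c i * ((i : ℝ) - 1) / RR i x := by
  rw [Finset.sum_comm]
  refine Finset.sum_congr rfl fun i hi => ?_
  have hi' := (RR_pos i hx).ne'
  rw [Finset.sum_sub_distrib, ← Finset.mul_sum]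
  have h1 : ∑ j : Fin (m + 1), (pv i x j) ^ 2 = RR i x := by
    rw [← norm_pv_sq, EuclideanSpace.norm_sq_eq]
    simp
  have h2 : ∑ j : Fin (m + 1), (if (j : ℕ) ≤ i then c i / RR i x else 0) =
      ((i : ℝ) + 1) * (c i / RR i x) := by
    rw [Fin.sum_univ_eq_sum_range (fun j => if j ≤ i then c i / RR i x else 0) (m + 1),
      ← Finset.sum_filter, Finset.sum_const]
    have : (Finset.range (m + 1)).filter (fun j => j ≤ i) = Finset.range (i + 1) := by
      ext j; simp at hi ⊢; omega
    rw [this]; simp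
  rw [h1, h2]
  field_simp
  ring

lemma contDiff_mul_of_tsupport {m : ℕ} {φ f : EE m → ℝ} (hφ : ContDiff ℝ (⊤ : ℕ∞) φ)
    (hs : tsupport φ ⊆ HH m) (hf : ContDiffOn ℝ (⊤ : ℕ∞) f (HH m)) :
    ContDiff ℝ (⊤ : ℕ∞) (fun x => φ x * f x) := by
  rw [contDiff_iff_contDiffAt]
  intro x
  by_cases hx : x ∈ HH m
  · exact hφ.contDiffAt.mul (hf.contDiffAt ((isOpen_HH m).mem_nhds hx))
  · have : (fun x => φ x * f x) =ᶠ[nhds x] fun _ => 0 := by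
      have h2 : x ∉ tsupport φ := fun h => hx (hs h)
      filter_upwards [notMem_tsupport_iff_eventuallyEq.1 h2] with y hy
      simp [hy]
    exact contDiffAt_const.congr_of_eventuallyEq this

def VV {m : ℕ} (b : ℕ → ℝ) (x : EE m) : ℝ := ∑ i ∈ Finset.range (m + 1), b i / RR i x

lemma contDiffOn_VV {m : ℕ} (b : ℕ → ℝ) :
    ContDiffOn ℝ (⊤ : ℕ∞) (VV b : EE m → ℝ) (HH m) := by
  unfold VV
  refine ContDiffOn.sum fun i _ => contDiffOn_const.div (contDiff_RR i).contDiffOn ?_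
  intro x hx
  exact (RR_pos i hx).ne'

lemma ground_identity {m : ℕ} (c b : ℕ → ℝ)
    (hb : ∀ i ≤ m, b i = -(c i ^ 2 + 2 * c i * ∑ k ∈ Finset.range i, c k + c i * ((i : ℝ) - 1)))
    (φ : EE m → ℝ) (hφ : ContDiff ℝ (⊤ : ℕ∞) φ) (hc : HasCompactSupport φ)
    (hs : tsupport φ ⊆ HH m) :
    Integrable (fun x => ‖gradient φ x - φ x • FF c x‖ ^ 2) ∧
    ∫ x in HH m, ‖gradient φ x‖ ^ 2 = (∫ x in HH m, VV b x * φ x ^ 2) +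
      ∫ x, ‖gradient φ x - φ x • FF c x‖ ^ 2 := by
  have hout : ∀ x, x ∉ HH m → φ x = 0 ∧ gradient φ x = 0 := by
    intro x hx
    have h2 : x ∉ tsupport φ := fun h => hx (hs h)
    refine ⟨image_eq_zero_of_notMem_tsupport h2, ?_⟩
    have h3 := notMem_tsupport_iff_eventuallyEq.1 h2
    unfold gradient
    rw [h3.fderiv_eq]
    simp
  have hgc : Continuous (gradient φ) :=
    (InnerProductSpace.toDual ℝ (EE m)).symm.continuous.comp (hφ.continuous_fderiv (by simp))
  have hgs : HasCompactSupport (gradient φ) := by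
    have := hc.fderiv (𝕜 := ℝ)
    exact this.comp_left (g := (InnerProductSpace.toDual ℝ (EE m)).symm) (by simp)
  set h : Fin (m + 1) → EE m → ℝ := fun j x => φ x * FF c x j with hh
  have hhC : ∀ j, ContDiff ℝ (⊤ : ℕ∞) (h j) := fun j =>
    contDiff_mul_of_tsupport hφ hs (contDiffOn_FF c j)
  have hhs : ∀ j, HasCompactSupport (h j) := fun j => hc.mul_right
  have hVc : Continuous fun x => φ x * VV b x :=
    (contDiff_mul_of_tsupport hφ hs (contDiffOn_VV b)).continuous
  have hFc : Continuous fun x => φ x • FF c x := by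
    have : (fun x => φ x • FF c x) = fun x => WithLp.toLp 2 (fun j => h j x) := by
      funext x; ext j; simp [hh]
    rw [this]
    have h1 : Continuous fun x => (fun j => h j x) := continuous_pi fun j => (hhC j).continuous
    exact (PiLp.continuous_toLp 2 _).comp h1
  have i1 : Integrable (fun x => ‖gradient φ x‖ ^ 2) := by
    refine Continuous.integrable_of_hasCompactSupport (by fun_prop) ?_
    exact hgs.comp_left (g := fun v => ‖v‖ ^ 2) (by simp)
  have i2 : Integrable (fun x => VV b x * φ x ^ 2) := by
    have e : (fun x => VV b x * φ x ^ 2) = fun x => φ x * (φ x * VV b x) := by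
      funext x; ring
    rw [e]
    exact Continuous.integrable_of_hasCompactSupport (hφ.continuous.mul hVc) hc.mul_right
  have i3 : Integrable (fun x => ‖gradient φ x - φ x • FF c x‖ ^ 2) := by
    refine Continuous.integrable_of_hasCompactSupport (by fun_prop) ?_
    have h1 : HasCompactSupport (fun x => gradient φ x - φ x • FF c x) := hgs.sub hc.smul_right
    exact h1.comp_left (g := fun v => ‖v‖ ^ 2) (by simp)
  refine ⟨i3, ?_⟩
  rw [setIntegral_eq_integral_of_forall_compl_eq_zero (fun x hx => by simp [(hout x hx).2]),
    setIntegral_eq_integral_of_forall_compl_eq_zero (fun x hx => by simp [(hout x hx).1])]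
  have hpt : ∀ x, ‖gradient φ x‖ ^ 2 - VV b x * φ x ^ 2 - ‖gradient φ x - φ x • FF c x‖ ^ 2 =
      ∑ j, (φ x * fderiv ℝ (h j) x (EuclideanSpace.single j 1) +
        fderiv ℝ φ x (EuclideanSpace.single j 1) * h j x) := by
    intro x
    by_cases hx : x ∈ HH m
    · have e1 : ∀ j, fderiv ℝ φ x (EuclideanSpace.single j 1) = gradient φ x j := by
        intro j
        have := InnerProductSpace.toDual_symm_apply (𝕜 := ℝ) (x := EuclideanSpace.single j (1 : ℝ))
          (y := fderiv ℝ φ x)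
        rw [← this, EuclideanSpace.inner_single_right]
        simp [gradient]
      choose f' hf' hf1 using hasFDerivAt_FF c x hx
      have e2 : ∀ j, fderiv ℝ (h j) x (EuclideanSpace.single j 1) =
          φ x * f' j (EuclideanSpace.single j 1) + FF c x j * gradient φ x j := by
        intro j
        have := (hφ.differentiable (by simp) x).hasFDerivAt.mul (hf' j)
        have h5 : fderiv ℝ (h j) x = _ := this.fderiv
        rw [h5]
        simp [e1]
      have e3 : ∑ j, f' j (EuclideanSpace.single j 1) =
          ∑ i ∈ Finset.range (m + 1), c i * ((i : ℝ) - 1) / RR i x := by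
        rw [← sum_div_FF c x hx]
        exact Finset.sum_congr rfl fun j _ => hf1 j
      have e4 : inner ℝ (gradient φ x) (FF c x) = ∑ j, gradient φ x j * FF c x j := by
        rw [PiLp.inner_apply]
        refine Finset.sum_congr rfl fun j _ => ?_
        simp [mul_comm]
      have e5 : VV b x = - ‖FF c x‖ ^ 2 - ∑ j, f' j (EuclideanSpace.single j 1) := by
        rw [e3, norm_FF_sq c x hx, VV, ← Finset.sum_neg_distrib, ← Finset.sum_sub_distrib]
        refine Finset.sum_congr rfl fun i hi => ?_
        rw [hb i (by simp at hi; omega)]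
        ring
      have e6 : ∑ j, (φ x * fderiv ℝ (h j) x (EuclideanSpace.single j 1) +
          fderiv ℝ φ x (EuclideanSpace.single j 1) * h j x) =
          φ x ^ 2 * ∑ j, f' j (EuclideanSpace.single j 1) +
          2 * φ x * ∑ j, gradient φ x j * FF c x j := by
        rw [Finset.mul_sum, Finset.mul_sum, ← Finset.sum_add_distrib]
        refine Finset.sum_congr rfl fun j _ => ?_
        rw [e2, e1]
        simp only [hh]
        ring
      rw [e6, ← e4, e5, norm_sub_sq_real, norm_smul, real_inner_smul_right, mul_pow,
        Real.norm_eq_abs, sq_abs]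
      ring
    · have hd : ∀ v, fderiv ℝ φ x v = 0 := by
        intro v
        have h2 : x ∉ tsupport φ := fun h => hx (hs h)
        rw [(notMem_tsupport_iff_eventuallyEq.1 h2).fderiv_eq]
        simp
      simp [(hout x hx).1, (hout x hx).2, hd]
  have hz : ∀ j, ∫ x, (φ x * fderiv ℝ (h j) x (EuclideanSpace.single j 1) +
        fderiv ℝ φ x (EuclideanSpace.single j 1) * h j x) = 0 ∧
      Integrable (fun x => φ x * fderiv ℝ (h j) x (EuclideanSpace.single j 1) +
        fderiv ℝ φ x (EuclideanSpace.single j 1) * h j x) := by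
    intro j
    have c1 : Continuous fun x => fderiv ℝ (h j) x (EuclideanSpace.single j 1) :=
      ((hhC j).continuous_fderiv (by simp)).clm_apply continuous_const
    have c2 : Continuous fun x => fderiv ℝ φ x (EuclideanSpace.single j 1) :=
      (hφ.continuous_fderiv (by simp)).clm_apply continuous_const
    have c3 := (hhC j).continuous
    have j1 : Integrable (fun x => φ x * fderiv ℝ (h j) x (EuclideanSpace.single j 1)) :=
      Continuous.integrable_of_hasCompactSupport (hφ.continuous.mul c1) hc.mul_right
    have j2 : Integrable (fun x => fderiv ℝ φ x (EuclideanSpace.single j 1) * h j x) :=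
      Continuous.integrable_of_hasCompactSupport (c2.mul c3) (hhs j).mul_left
    have j3 : Integrable (fun x => φ x * h j x) :=
      Continuous.integrable_of_hasCompactSupport (hφ.continuous.mul c3) hc.mul_right
    refine ⟨?_, j1.add j2⟩
    rw [integral_add j1 j2, integral_mul_fderiv_eq_neg_fderiv_mul_of_integrable j2 j1 j3]
    · ring
    · intros; exact hφ.differentiable (by simp) _
    · intros; exact (hhC j).differentiable (by simp) _
  have hIntg : ∫ x, (‖gradient φ x‖ ^ 2 - VV b x * φ x ^ 2 - ‖gradient φ x - φ x • FF c x‖ ^ 2) = 0 := by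
    simp only [hpt]
    rw [integral_finsetSum _ fun j _ => (hz j).2]
    exact Finset.sum_eq_zero fun j _ => (hz j).1
  have i12 : Integrable (fun x => ‖gradient φ x‖ ^ 2 - VV b x * φ x ^ 2) := i1.sub i2
  rw [integral_sub i12 i3, integral_sub i1 i2] at hIntg
  linarith

/-! ### Part 3: cutoff functions -/

lemma exists_cutoff : ∃ χ : ℝ → ℝ, ContDiff ℝ (⊤ : ℕ∞) χ ∧ (∀ s, |s| ≤ 1 → χ s = 1) ∧
    (∀ s, 2 ≤ |s| → χ s = 0) ∧ (∀ s, 0 ≤ χ s ∧ χ s ≤ 1) ∧ ∃ B, ∀ s, |deriv χ s| ≤ B := by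
  let f : ContDiffBump (0 : ℝ) := ⟨1, 2, by norm_num, by norm_num⟩
  refine ⟨f, f.contDiff, fun s hs => ?_, fun s hs => ?_, fun s => ⟨f.nonneg, f.le_one⟩, ?_⟩
  · exact f.one_of_mem_closedBall (by simpa using hs)
  · exact f.zero_of_le_dist (by simpa using hs)
  · have h1 : HasCompactSupport (deriv f) := f.hasCompactSupport.deriv
    have h2 : Continuous (deriv f) := (f.contDiff (n := 1)).continuous_deriv le_rfl
    obtain ⟨B, hB⟩ := h1.exists_bound_of_continuous h2
    exact ⟨B, hB⟩

lemma deriv_cutoff_zero {χ : ℝ → ℝ} (h : ∀ s, 2 ≤ |s| → χ s = 0) (s : ℝ) (hs : 2 < |s|) :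
    deriv χ s = 0 := by
  have : χ =ᶠ[nhds s] fun _ => 0 := by
    have : {t : ℝ | 2 < |t|} ∈ nhds s := (isOpen_lt continuous_const continuous_abs).mem_nhds hs
    filter_upwards [this] with t ht
    exact h t (le_of_lt ht)
  rw [this.deriv_eq]; simp

def uu {m : ℕ} (c : ℕ → ℝ) (x : EE m) : ℝ :=
  Real.exp (∑ i ∈ Finset.range (m + 1), (c i / 2) * Real.log (RR i x))

def et {m : ℕ} (χ : ℝ → ℝ) (M : ℕ → ℝ) (x : EE m) : ℝ :=
  ∏ i ∈ Finset.range (m + 1), χ (Real.log (RR i x) / M i)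

def ph {m : ℕ} (c : ℕ → ℝ) (χ : ℝ → ℝ) (M : ℕ → ℝ) : EE m → ℝ :=
  (HH m).indicator (fun x => uu c x * et χ M x)

lemma uu_sq {m : ℕ} (c : ℕ → ℝ) (x : EE m) (hx : x ∈ HH m) :
    uu c x ^ 2 = ∏ i ∈ Finset.range (m + 1), Qs i x.ofLp ^ c i := by
  unfold uu
  rw [← Real.exp_nat_mul, Finset.mul_sum, Real.exp_sum]
  refine Finset.prod_congr rfl fun i _ => ?_
  rw [show Qs i x.ofLp = RR i x from rfl, Real.rpow_def_of_pos (RR_pos i hx)]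
  congr 1
  push_cast; ring

lemma hasFDerivAt_log_RR {m : ℕ} (i : ℕ) (x : EE m) (hx : x ∈ HH m) :
    HasFDerivAt (fun y : EE m => Real.log (RR i y)) (innerSL ℝ ((2 / RR i x) • pv i x)) x := by
  refine ((hasFDerivAt_RR i x).log (RR_pos i hx).ne').congr_fderiv ?_
  rw [map_smul, smul_smul]
  congr 1
  ring

lemma hasFDerivAt_uu {m : ℕ} (c : ℕ → ℝ) (x : EE m) (hx : x ∈ HH m) :
    HasFDerivAt (uu c : EE m → ℝ) (innerSL ℝ (uu c x • FF c x)) x := by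
  have h := HasFDerivAt.fun_sum (u := Finset.range (m + 1))
    (fun i _ => (hasFDerivAt_log_RR i x hx).const_mul (c i / 2))
  refine h.exp.congr_fderiv ?_
  rw [map_smul]
  unfold FF
  rw [map_sum]
  congr 1
  refine Finset.sum_congr rfl fun i _ => ?_
  rw [← map_smul, smul_smul]
  congr 2
  ring

def GG {m : ℕ} (χ : ℝ → ℝ) (M : ℕ → ℝ) (x : EE m) : EE m :=
  ∑ i ∈ Finset.range (m + 1), ((∏ j ∈ (Finset.range (m + 1)).erase i,
    χ (Real.log (RR j x) / M j)) * (deriv χ (Real.log (RR i x) / M i) / M i * (2 / RR i x))) • pv i x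

lemma hasFDerivAt_et {m : ℕ} {χ : ℝ → ℝ} (hχ : ContDiff ℝ (⊤ : ℕ∞) χ) (M : ℕ → ℝ)
    (x : EE m) (hx : x ∈ HH m) :
    HasFDerivAt (et χ M : EE m → ℝ) (innerSL ℝ (GG χ M x)) x := by
  have h1 : ∀ i ∈ Finset.range (m + 1), HasFDerivAt (fun y : EE m => χ (Real.log (RR i y) / M i))
      (innerSL ℝ ((deriv χ (Real.log (RR i x) / M i) / M i * (2 / RR i x)) • pv i x)) x := by
    intro i _
    have hd : HasDerivAt χ (deriv χ (Real.log (RR i x) / M i)) (Real.log (RR i x) / M i) :=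
      (hχ.differentiable (by simp) _).hasDerivAt
    have h2 := (hasFDerivAt_log_RR i x hx).mul_const ((M i)⁻¹)
    simp only [← div_eq_mul_inv] at h2
    refine (hd.comp_hasFDerivAt x h2).congr_fderiv ?_
    rw [← map_smul, ← map_smul, smul_smul, smul_smul]
    congr 2
  have h := HasFDerivAt.finsetProd h1
  refine h.congr_fderiv ?_
  unfold GG
  rw [map_sum]
  refine Finset.sum_congr rfl fun i _ => ?_
  rw [← map_smul, smul_smul]

lemma gradient_ph {m : ℕ} (c : ℕ → ℝ) {χ : ℝ → ℝ} (hχ : ContDiff ℝ (⊤ : ℕ∞) χ) (M : ℕ → ℝ)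
    (x : EE m) (hx : x ∈ HH m) :
    gradient (ph c χ M) x - ph c χ M x • FF c x = uu c x • GG χ M x := by
  have e : (ph c χ M : EE m → ℝ) =ᶠ[nhds x] fun y => uu c y * et χ M y := by
    filter_upwards [(isOpen_HH m).mem_nhds hx] with y hy
    simp [ph, hy]
  have h := ((hasFDerivAt_uu c x hx).mul (hasFDerivAt_et hχ M x hx)).congr_of_eventuallyEq e
  unfold gradient
  rw [h.fderiv, ← map_smul, ← map_smul, ← map_add]
  have : ∀ v : EE m, (InnerProductSpace.toDual ℝ (EE m)).symm (innerSL ℝ v) = v := by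
    intro v
    rw [LinearIsometryEquiv.symm_apply_eq]
    ext w; simp
  rw [this, e.eq_of_nhds, smul_smul, mul_comm (et χ M x)]
  abel

lemma norm_GG_sq {m : ℕ} {χ : ℝ → ℝ} (h01 : ∀ s, 0 ≤ χ s ∧ χ s ≤ 1) (h2 : ∀ s, 2 ≤ |s| → χ s = 0)
    {B : ℝ} (hB : ∀ s, |deriv χ s| ≤ B) (M : ℕ → ℝ) (hM : ∀ i, 0 < M i)
    (x : EE m) (hx : x ∈ HH m) :
    ‖GG χ M x‖ ^ 2 ≤ ∑ i ∈ Finset.range (m + 1),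
      if |Real.log (RR i x)| ≤ 2 * M i ∧ ∀ j ≤ m, i < j → |Real.log (RR j x)| ≤ 2 * M j then
        ((m + 1) * 4 * B ^ 2) / (M i ^ 2 * RR i x) else 0 := by
  unfold GG
  refine (pow_le_pow_left₀ (norm_nonneg _) (norm_sum_le _ _) 2).trans ?_
  refine sq_sum_le_card_mul_sum_sq.trans ?_
  rw [Finset.card_range, Finset.mul_sum]
  refine Finset.sum_le_sum fun i hi => ?_
  have hR := RR_pos i hx
  have hMi := hM i
  have hbig : ∀ j, ¬ |Real.log (RR j x)| ≤ 2 * M j → 2 < |Real.log (RR j x) / M j| := by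
    intro j hj
    rw [abs_div, abs_of_pos (hM j), lt_div_iff₀ (hM j)]
    exact not_le.1 hj
  split_ifs with hc
  · rw [norm_smul, mul_pow, norm_pv_sq, Real.norm_eq_abs, abs_mul, mul_pow]
    have hp : |∏ j ∈ (Finset.range (m + 1)).erase i, χ (Real.log (RR j x) / M j)| ≤ 1 := by
      rw [Finset.abs_prod]
      refine Finset.prod_le_one (fun j _ => abs_nonneg _) fun j _ => ?_
      rw [abs_of_nonneg (h01 _).1]; exact (h01 _).2
    have hp2 : |∏ j ∈ (Finset.range (m + 1)).erase i, χ (Real.log (RR j x) / M j)| ^ 2 ≤ 1 :=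
      pow_le_one₀ (abs_nonneg _) hp
    have hd2 : |deriv χ (Real.log (RR i x) / M i) / M i * (2 / RR i x)| ^ 2 ≤
        (B / M i * (2 / RR i x)) ^ 2 := by
      refine pow_le_pow_left₀ (abs_nonneg _) ?_ 2
      rw [abs_mul, abs_div, abs_of_pos hMi, abs_of_pos (by positivity : 0 < 2 / RR i x)]
      gcongr
      exact hB _
    calc _ ≤ ((m + 1 : ℕ) : ℝ) * (1 * (B / M i * (2 / RR i x)) ^ 2 * RR i x) := by gcongr
      _ = _ := by push_cast; field_simp; ring
  · apply le_of_eq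
    rw [not_and_or] at hc
    have hzero : (∏ j ∈ (Finset.range (m + 1)).erase i, χ (Real.log (RR j x) / M j)) *
        (deriv χ (Real.log (RR i x) / M i) / M i * (2 / RR i x)) = 0 := by
      rcases hc with hc | hc
      · rw [deriv_cutoff_zero h2 _ (hbig i hc)]; simp
      · push Not at hc
        obtain ⟨j, hj, hij, hj2⟩ := hc
        have : ∏ j ∈ (Finset.range (m + 1)).erase i, χ (Real.log (RR j x) / M j) = 0 := by
          refine Finset.prod_eq_zero (i := j) ?_ (h2 _ (hbig j (not_le.2 hj2)).le)
          simp; omega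
        rw [this, zero_mul]
    rw [hzero]; simp

lemma ph_test {m : ℕ} (c : ℕ → ℝ) {χ : ℝ → ℝ} (hχ : ContDiff ℝ (⊤ : ℕ∞) χ)
    (h2 : ∀ s, 2 ≤ |s| → χ s = 0) (M : ℕ → ℝ) (hM : ∀ i, 0 < M i) :
    ContDiff ℝ (⊤ : ℕ∞) (ph c χ M : EE m → ℝ) ∧ HasCompactSupport (ph c χ M : EE m → ℝ) ∧
      tsupport (ph c χ M : EE m → ℝ) ⊆ HH m := by
  set K : Set (EE m) := {x | Real.exp (-M 0) ≤ x 0} ∩ Metric.closedBall 0 (Real.exp (M m)) with hK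
  have hcl : IsClosed {x : EE m | Real.exp (-M 0) ≤ x 0} := by
    have : Continuous fun x : EE m => x 0 := by fun_prop
    exact isClosed_le continuous_const this
  have hKc : IsCompact K := (isCompact_closedBall _ _).inter_left hcl
  have hKH : K ⊆ HH m := fun x hx => (Real.exp_pos _).trans_le hx.1
  have hsupp : Function.support (ph c χ M : EE m → ℝ) ⊆ K := by
    intro x hx
    have hxH : x ∈ HH m := by
      by_contra h
      exact hx (by simp [ph, h])
    have hne : et χ M x ≠ 0 := by
      intro h
      exact hx (by simp [ph, h])
    have hall : ∀ i ≤ m, |Real.log (RR i x)| ≤ 2 * M i := by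
      intro i hi
      by_contra h
      apply hne
      refine Finset.prod_eq_zero (i := i) (by simp; omega) (h2 _ ?_)
      rw [abs_div, abs_of_pos (hM i), le_div_iff₀ (hM i)]
      exact (not_le.1 h).le
    have hx0 : 0 < x 0 := hxH
    constructor
    · have := (abs_le.1 (hall 0 (Nat.zero_le _))).1
      have e : RR 0 x = x 0 ^ 2 := by
        simp only [RR, Qs]
        rw [Fin.sum_univ_succ]; simp
      rw [e, Real.log_pow] at this
      push_cast at this
      show Real.exp (-M 0) ≤ x 0
      rw [← Real.le_log_iff_exp_le hx0]
      linarith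
    · have := (abs_le.1 (hall m le_rfl)).2
      have e : RR m x = ‖x‖ ^ 2 := by
        rw [EuclideanSpace.norm_sq_eq]
        simp only [RR, Qs]
        refine Finset.sum_congr rfl fun j _ => ?_
        have := j.2
        rw [if_pos (by omega)]; simp
      rw [e, Real.log_pow] at this
      push_cast at this
      rw [mem_closedBall_zero_iff]
      have hn : 0 < ‖x‖ := by
        rw [norm_pos_iff]; rintro rfl; simp at hx0
      rw [← Real.log_le_iff_le_exp hn]
      linarith
  have hts : tsupport (ph c χ M : EE m → ℝ) ⊆ K := closure_minimal hsupp hKc.isClosed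
  refine ⟨?_, hKc.of_isClosed_subset (isClosed_tsupport _) hts, hts.trans hKH⟩
  rw [contDiff_iff_contDiffAt]
  intro x
  by_cases hx : x ∈ HH m
  · have e : (ph c χ M : EE m → ℝ) =ᶠ[nhds x] fun y => uu c y * et χ M y := by
      filter_upwards [(isOpen_HH m).mem_nhds hx] with y hy
      simp [ph, hy]
    refine ContDiffAt.congr_of_eventuallyEq ?_ e
    have hl : ∀ i, ContDiffAt ℝ (⊤ : ℕ∞) (fun y : EE m => Real.log (RR i y)) x := fun i =>
      (contDiff_RR i).contDiffAt.log (RR_pos i hx).ne'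
    refine ContDiffAt.mul ?_ ?_
    · exact (ContDiffAt.sum fun i _ => contDiffAt_const.mul (hl i)).exp
    · unfold et
      refine contDiffAt_prod fun i _ => ?_
      exact hχ.contDiffAt.comp x ((hl i).div_const _)
  · have hxK : x ∉ K := fun h => hx (hKH h)
    have e : (ph c χ M : EE m → ℝ) =ᶠ[nhds x] fun _ => 0 := by
      filter_upwards [hKc.isClosed.isOpen_compl.mem_nhds hxK] with y hy
      by_contra h
      exact hy (hsupp h)
    exact contDiffAt_const.congr_of_eventuallyEq e

/-! ### Part 4: smallness of the energy and conclusion -/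

def gM (m i : ℕ) (A C0 M : ℝ) : ℝ → ℝ≥0∞ :=
  {s : ℝ | |Real.log s| ≤ 2 * M ∧ (i = m ∨ Real.log s ≤ A)}.indicator
    (fun s => ENNReal.ofReal (C0 / (M ^ 2 * s)))

lemma measurable_gM (m i : ℕ) (A C0 M : ℝ) : Measurable (gM m i A C0 M) := by
  refine Measurable.indicator (by fun_prop) ?_
  refine MeasurableSet.inter (s₁ := {s | |Real.log s| ≤ 2 * M})
    (s₂ := {s | i = m ∨ Real.log s ≤ A}) ?_ ?_
  · exact measurableSet_le (f := fun s => |Real.log s|) Real.measurable_log.norm measurable_const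
  · by_cases h : i = m
    · simp [h]
    · simp only [h, false_or]
      exact measurableSet_le Real.measurable_log measurable_const

lemma gM_bound (a : ℕ → ℝ) (ha : ∀ i, a i ≤ 0) (m i : ℕ) (ham : a m = 0) (A C0 M : ℝ)
    (hC0 : 0 ≤ C0) (hM : 0 < M) :
    ∫⁻ r in Set.Ioi (0 : ℝ), ENNReal.ofReal (r ^ (1 - 2 * a i)) * gM m i A C0 M (r ^ 2) ≤
      ENNReal.ofReal (2 * Real.exp (-a i * A) * C0 / M) := by
  have hpt : ∀ r ∈ Set.Ioi (0 : ℝ),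
      ENNReal.ofReal (r ^ (1 - 2 * a i)) * gM m i A C0 M (r ^ 2) ≤
      (Set.Icc (Real.exp (-M)) (Real.exp M)).indicator
        (fun r => ENNReal.ofReal (Real.exp (-a i * A) * C0 / M ^ 2 * r⁻¹)) r := by
    intro r hr
    have hr : 0 < r := hr
    unfold gM
    by_cases hs : r ^ 2 ∈ {s : ℝ | |Real.log s| ≤ 2 * M ∧ (i = m ∨ Real.log s ≤ A)}
    · rw [Set.indicator_of_mem hs]
      obtain ⟨h1, h2⟩ := hs
      rw [Real.log_pow] at h1 h2
      push_cast at h1 h2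
      rw [abs_le] at h1
      have hmem : r ∈ Set.Icc (Real.exp (-M)) (Real.exp M) := by
        constructor
        · rw [← Real.le_log_iff_exp_le hr]; linarith
        · rw [← Real.log_le_iff_le_exp hr]; linarith
      rw [Set.indicator_of_mem hmem, ← ENNReal.ofReal_mul (by positivity)]
      apply ENNReal.ofReal_le_ofReal
      have h3 : r ^ (1 - 2 * a i) ≤ r * Real.exp (-a i * A) := by
        rw [sub_eq_add_neg, Real.rpow_add hr, Real.rpow_one]
        gcongr
        rw [Real.rpow_def_of_pos hr]
        apply Real.exp_le_exp.2
        rcases h2 with h2 | h2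
        · subst h2; rw [ham]; simp
        · nlinarith [ha i]
      calc r ^ (1 - 2 * a i) * (C0 / (M ^ 2 * r ^ 2)) ≤
          (r * Real.exp (-a i * A)) * (C0 / (M ^ 2 * r ^ 2)) := by gcongr
        _ = _ := by field_simp
    · rw [Set.indicator_of_notMem hs]; simp
  refine (setLIntegral_mono' measurableSet_Ioi hpt).trans ?_
  refine (setLIntegral_le_lintegral _ _).trans ?_
  rw [lintegral_indicator measurableSet_Icc]
  have hle : Real.exp (-M) ≤ Real.exp M := Real.exp_le_exp.2 (by linarith)
  have hcont : ContinuousOn (fun r : ℝ => Real.exp (-a i * A) * C0 / M ^ 2 * r⁻¹)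
      (Set.Icc (Real.exp (-M)) (Real.exp M)) := by
    refine continuousOn_const.mul (continuousOn_inv₀.mono ?_)
    intro r hr
    exact ((Real.exp_pos _).trans_le hr.1).ne'
  rw [← ofReal_integral_eq_lintegral_ofReal hcont.integrableOn_Icc]
  · apply ENNReal.ofReal_le_ofReal
    rw [integral_Icc_eq_integral_Ioc, ← intervalIntegral.integral_of_le hle,
      intervalIntegral.integral_const_mul, integral_inv_of_pos (Real.exp_pos _) (Real.exp_pos _),
      ← Real.exp_sub, Real.log_exp]
    apply le_of_eq
    field_simp
    ring
  · filter_upwards [ae_restrict_mem measurableSet_Icc] with r hr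
    have : 0 < r := (Real.exp_pos _).trans_le hr.1
    show 0 ≤ _
    positivity

lemma small_energy (a : ℕ → ℝ) (ha : ∀ i, a i ≤ 0) (m : ℕ) (ham : a m = 0) (A C0 : ℝ)
    (hC0 : 0 ≤ C0) (δ : ℝ) (hδ : 0 < δ) :
    ∃ M, A ≤ M ∧ ∀ i ≤ m, ∫⁻ x : Fin (m + 1) → ℝ, wt a m i A x * gM m i A C0 M (Qs i x) ≤
      ENNReal.ofReal δ := by
  have hev : ∀ i ∈ Finset.range (m + 1), ∀ᶠ M in Filter.atTop,
      ∫⁻ x : Fin (m + 1) → ℝ, wt a m i A x * gM m i A C0 M (Qs i x) ≤ ENNReal.ofReal δ := by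
    intro i hi
    obtain ⟨C, hC, hb⟩ := key_bound a ha A m i (by simp at hi; omega)
    have hlim : Filter.Tendsto (fun M : ℝ => C.toReal * (2 * Real.exp (-a i * A) * C0 / M))
        Filter.atTop (nhds 0) := by
      have := (Filter.Tendsto.const_div_atTop (Filter.tendsto_id (α := ℝ))
        (2 * Real.exp (-a i * A) * C0)).const_mul C.toReal
      simpa using this
    filter_upwards [hlim.eventually (gt_mem_nhds hδ), Filter.eventually_gt_atTop 0] with M h1 h2
    refine (hb _ (measurable_gM m i A C0 M)).trans ?_
    refine (mul_le_mul_right (gM_bound a ha m i ham A C0 M hC0 h2) C).trans ?_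
    rw [← ENNReal.ofReal_toReal hC, ← ENNReal.ofReal_mul ENNReal.toReal_nonneg]
    exact ENNReal.ofReal_le_ofReal h1.le
  have h2 := (Filter.eventually_all_finset _).2 hev
  obtain ⟨M, hM, hA⟩ := (h2.and (Filter.eventually_ge_atTop A)).exists
  exact ⟨M, hA, fun i hi => hM i (by simp; omega)⟩

lemma energy_pt {m : ℕ} (a : ℕ → ℝ) {χ : ℝ → ℝ} (hχ : ContDiff ℝ (⊤ : ℕ∞) χ)
    (h01 : ∀ s, 0 ≤ χ s ∧ χ s ≤ 1) (h2 : ∀ s, 2 ≤ |s| → χ s = 0)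
    {B : ℝ} (hB : ∀ s, |deriv χ s| ≤ B) (M : ℕ → ℝ) (hM : ∀ i, 0 < M i) (hanti : Antitone M)
    (x : EE m) :
    ENNReal.ofReal (‖gradient (ph (cc a) χ M) x - ph (cc a) χ M x • FF (cc a) x‖ ^ 2) ≤
      ∑ i ∈ Finset.range (m + 1), wt a m i (2 * M (i + 1)) x.ofLp *
        gM m i (2 * M (i + 1)) ((m + 1) * 4 * B ^ 2) (M i) (Qs i x.ofLp) := by
  by_cases hx : x ∈ HH m
  · rw [gradient_ph _ hχ M x hx, norm_smul, mul_pow, Real.norm_eq_abs, sq_abs]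
    refine (ENNReal.ofReal_le_ofReal (mul_le_mul_of_nonneg_left
      (norm_GG_sq h01 h2 hB M hM x hx) (sq_nonneg _))).trans ?_
    rw [Finset.mul_sum, ENNReal.ofReal_sum_of_nonneg]
    · refine Finset.sum_le_sum fun i hi => ?_
      split_ifs with hc
      · have hx1 : x.ofLp ∈ goodSet m i (2 * M (i + 1)) := by
          refine ⟨hx, fun j hj hij => ?_⟩
          have := hanti (show i + 1 ≤ j by omega)
          exact (hc.2 j hj hij).trans (by linarith)
        have hx2 : Qs i x.ofLp ∈ {s : ℝ | |Real.log s| ≤ 2 * M i ∧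
            (i = m ∨ Real.log s ≤ 2 * M (i + 1))} := by
          refine ⟨hc.1, ?_⟩
          by_cases him : i = m
          · exact Or.inl him
          · right
            have hi' : i + 1 ≤ m := by simp at hi; omega
            have h3 := hc.2 (i + 1) hi' (by omega)
            refine le_trans (Real.log_le_log (RR_pos i hx) (Qs_mono (Nat.le_succ i) _)) ?_
            exact (le_abs_self _).trans h3
        simp only [wt, gM]
        rw [Set.indicator_of_mem hx1, Set.indicator_of_mem hx2, ← uu_sq _ x hx,
          ENNReal.ofReal_mul (sq_nonneg _)]
        rfl
      · simp
    · intro i _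
      have := RR_pos i hx
      have := hM i
      split_ifs <;> positivity
  · have ht := (ph_test (m := m) (cc a) hχ h2 M hM).2.2
    have h3 : x ∉ tsupport (ph (cc a) χ M : EE m → ℝ) := fun h => hx (ht h)
    have h4 := notMem_tsupport_iff_eventuallyEq.1 h3
    have h5 : gradient (ph (cc a) χ M) x = 0 := by
      unfold gradient
      rw [h4.fderiv_eq]; simp
    rw [h5, h4.eq_of_nhds]; simp

lemma cc_sum (a : ℕ → ℝ) (i : ℕ) : ∑ k ∈ Finset.range (i + 1), cc a k = - a i - ((i : ℝ) - 1) / 2 := by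
  induction i with
  | zero => simp [cc]; ring
  | succ i ih => rw [Finset.sum_range_succ, ih]; simp only [cc]; push_cast; ring

lemma main_aux (m : ℕ) (a b : ℕ → ℝ) (ha : ∀ i, a i ≤ 0) (ham : a m = 0)
    (hb0 : b 0 = 1 / 4 - a 0 ^ 2)
    (hb : ∀ i, i + 1 ≤ m → b (i + 1) = (a i - 1 / 2) ^ 2 - a (i + 1) ^ 2)
    (W : EE m → ℝ≥0∞) (hW : Measurable W) (hWpos : 0 < volume {x | x ∈ HH m ∧ 0 < W x}) :
    ∃ φ : EE m → ℝ, IsTestFun (HH m) φ ∧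
      ((∫⁻ x in HH m, W x * ENNReal.ofReal ((φ x) ^ 2)) = ⊤ ∨
        (∫ x in HH m, ‖gradient φ x‖ ^ 2) < (∫ x in HH m, VV b x * (φ x) ^ 2)
            + (∫⁻ x in HH m, W x * ENNReal.ofReal ((φ x) ^ 2)).toReal) := by
  obtain ⟨χ, hχ, hχ1, hχ2, h01, B, hB⟩ := exists_cutoff
  -- a set where the weight is nontrivial
  set S : ℕ → Set (EE m) := fun N => {x | x ∈ HH m ∧ 0 < W x ∧ ∀ i ≤ m, |Real.log (RR i x)| ≤ N}
    with hS
  have hSm : ∀ N, MeasurableSet (S N) := by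
    intro N
    have e : S N = HH m ∩ ({x | 0 < W x} ∩ ⋂ i : ℕ, {x | i ≤ m → |Real.log (RR i x)| ≤ N}) := by
      ext x; simp [hS]; tauto
    rw [e]
    refine (isOpen_HH m).measurableSet.inter ((measurableSet_lt measurable_const hW).inter
      (MeasurableSet.iInter fun i => ?_))
    by_cases hi : i ≤ m
    · simp only [hi, true_imp_iff]
      exact measurableSet_le (f := fun x => |Real.log (RR i x)|)
        (Real.measurable_log.comp (contDiff_RR i).continuous.measurable).norm measurable_const
    · simp [hi]
  obtain ⟨N, hN⟩ : ∃ N, 0 < volume (S N) := by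
    by_contra hcon
    push Not at hcon
    have hz : volume (⋃ N, S N) = 0 := measure_iUnion_null fun N => le_antisymm (hcon N) bot_le
    have hsub : {x | x ∈ HH m ∧ 0 < W x} ⊆ ⋃ N, S N := by
      intro x hx
      obtain ⟨N, hN⟩ := exists_nat_ge (∑ i ∈ Finset.range (m + 1), |Real.log (RR i x)|)
      refine Set.mem_iUnion.2 ⟨N, hx.1, hx.2, fun i hi => le_trans ?_ hN⟩
      exact Finset.single_le_sum (f := fun i => |Real.log (RR i x)|) (fun _ _ => abs_nonneg _)
        (by simp; omega)
    exact absurd (measure_mono_null hsub hz) hWpos.ne'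
  have hSH : S N ⊆ HH m := fun x hx => hx.1
  have hupos : ∀ x : EE m, 0 < uu (cc a) x := fun x => Real.exp_pos _
  have hum : Measurable (uu (cc a) : EE m → ℝ) := by
    unfold uu
    refine Real.measurable_exp.comp (Finset.measurable_sum _ fun i _ => ?_)
    exact (Real.measurable_log.comp (contDiff_RR i).continuous.measurable).const_mul _
  have hI : 0 < ∫⁻ x in S N, W x * ENNReal.ofReal (uu (cc a) x ^ 2) := by
    have hWm : Measurable (fun x => W x * ENNReal.ofReal (uu (cc a) x ^ 2)) :=
      hW.mul (ENNReal.measurable_ofReal.comp (hum.pow_const 2))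
    rw [lintegral_pos_iff_support hWm,
      Measure.restrict_apply' (hSm N)]
    refine hN.trans_le (measure_mono fun x hx => ⟨?_, hx⟩)
    have h1 : ENNReal.ofReal (uu (cc a) x ^ 2) ≠ 0 := by
      have := hupos x
      simp only [ne_eq, ENNReal.ofReal_eq_zero, not_le]; positivity
    exact mul_ne_zero hx.2.1.ne' h1
  obtain ⟨δ, hδ0, hδ⟩ : ∃ δ : ℝ, 0 < δ ∧
      ENNReal.ofReal δ ≤ ∫⁻ x in S N, W x * ENNReal.ofReal (uu (cc a) x ^ 2) := by
    obtain ⟨r, hr0, hr1, hr2⟩ := ENNReal.lt_iff_exists_real_btwn.1 hI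
    exact ⟨r, ENNReal.ofReal_pos.1 hr1, hr2.le⟩
  -- the choice of the scales
  set C0 : ℝ := (m + 1) * 4 * B ^ 2 with hC0
  set δ' : ℝ := δ / (2 * (m + 1)) with hδ'
  have hδ'0 : 0 < δ' := by positivity
  choose G hG1 hG2 using fun A : ℝ =>
    small_energy a ha m ham A C0 (by positivity) δ' hδ'0
  set f : ℕ → ℝ := fun k => Nat.rec ((N : ℝ) + 1) (fun _ y => G (2 * y)) k with hf
  have hf0 : f 0 = N + 1 := rfl
  have hfs : ∀ k, f (k + 1) = G (2 * f k) := fun k => rfl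
  have hfge : ∀ k, (N : ℝ) + 1 ≤ f k := by
    intro k
    induction k with
    | zero => exact hf0.ge
    | succ k ih =>
      rw [hfs]
      have h0 : (0 : ℝ) ≤ N := Nat.cast_nonneg N
      linarith [hG1 (2 * f k)]
  have hfpos : ∀ k, 0 < f k := fun k => by
    have h0 : (0 : ℝ) ≤ N := Nat.cast_nonneg N
    linarith [hfge k]
  have hfm : Monotone f := monotone_nat_of_le_succ fun k => by
    rw [hfs]; linarith [hG1 (2 * f k), hfpos k]
  set M : ℕ → ℝ := fun i => f (m + 1 - i) with hMdef
  have hMpos : ∀ i, 0 < M i := fun i => hfpos _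
  have hanti : Antitone M := fun i j hij => hfm (by omega)
  have hMs : ∀ i ≤ m, M i = G (2 * M (i + 1)) := by
    intro i hi
    simp only [hMdef]
    rw [show m + 1 - i = (m - i) + 1 by omega, hfs, show m + 1 - (i + 1) = m - i by omega]
  obtain ⟨ht1, ht2, ht3⟩ := ph_test (m := m) (cc a) hχ hχ2 M hMpos
  refine ⟨ph (cc a) χ M, ⟨ht1, ht2, ht3⟩, ?_⟩
  rw [or_iff_not_imp_left]
  intro htop
  have hbc : ∀ i ≤ m, b i = -(cc a i ^ 2 + 2 * cc a i * ∑ k ∈ Finset.range i, cc a k +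
      cc a i * ((i : ℝ) - 1)) := by
    intro i hi
    cases i with
    | zero => rw [hb0]; simp [cc]; ring
    | succ i => rw [hb i hi, cc_sum]; simp only [cc]; push_cast; ring
  obtain ⟨hIntg, hid⟩ := ground_identity (cc a) b hbc (ph (cc a) χ M) ht1 ht2 ht3
  rw [hid]
  -- the energy is small
  have hE : ∫⁻ x : EE m, ENNReal.ofReal
      (‖gradient (ph (cc a) χ M) x - ph (cc a) χ M x • FF (cc a) x‖ ^ 2) ≤
      ENNReal.ofReal (δ / 2) := by
    refine (lintegral_mono (energy_pt a hχ h01 hχ2 hB M hMpos hanti)).trans ?_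
    have hmeas : ∀ i, Measurable fun y : Fin (m + 1) → ℝ => wt a m i (2 * M (i + 1)) y *
        gM m i (2 * M (i + 1)) C0 (M i) (Qs i y) := fun i =>
      measurable_wtg _ _ _ _ _ (measurable_gM _ _ _ _ _)
    rw [lintegral_finsetSum]
    · have hle : ∀ i ∈ Finset.range (m + 1), ∫⁻ x : EE m, wt a m i (2 * M (i + 1)) x.ofLp *
          gM m i (2 * M (i + 1)) C0 (M i) (Qs i x.ofLp) ≤ ENNReal.ofReal δ' := by
        intro i hi
        have hi' : i ≤ m := by simp at hi; omega
        rw [(PiLp.volume_preserving_ofLp (Fin (m + 1))).lintegral_comp (hmeas i)]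
        have := hG2 (2 * M (i + 1)) i hi'
        rwa [← hMs i hi'] at this
      refine (Finset.sum_le_sum hle).trans ?_
      rw [Finset.sum_const, Finset.card_range, nsmul_eq_mul, ← ENNReal.ofReal_natCast,
        ← ENNReal.ofReal_mul (by positivity)]
      apply ENNReal.ofReal_le_ofReal
      rw [hδ']
      push_cast
      apply le_of_eq
      field_simp
    · intro i _
      exact (hmeas i).comp (PiLp.volume_preserving_ofLp (Fin (m + 1))).measurable
  have hE2 : ∫ x : EE m, ‖gradient (ph (cc a) χ M) x - ph (cc a) χ M x • FF (cc a) x‖ ^ 2 ≤ δ / 2 := by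
    rw [← ofReal_integral_eq_lintegral_ofReal hIntg (Filter.Eventually.of_forall fun x => sq_nonneg _)]
      at hE
    exact (ENNReal.ofReal_le_ofReal_iff (by positivity)).1 hE
  -- the weight contributes
  have hWge : ENNReal.ofReal δ ≤ ∫⁻ x in HH m, W x * ENNReal.ofReal (ph (cc a) χ M x ^ 2) := by
    refine hδ.trans ?_
    refine le_trans (le_of_eq ?_) (lintegral_mono_set hSH)
    refine setLIntegral_congr_fun (hSm N) fun x hx => ?_
    have he : et χ M x = 1 := by
      refine Finset.prod_eq_one fun i hi => hχ1 _ ?_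
      rw [abs_div, abs_of_pos (hMpos i), div_le_one (hMpos i)]
      refine (hx.2.2 i (by simp at hi; omega)).trans ?_
      have := hfge (m + 1 - i)
      simp only [hMdef]; linarith
    simp [ph, hx.1, he]
  have hWge2 : δ ≤ (∫⁻ x in HH m, W x * ENNReal.ofReal (ph (cc a) χ M x ^ 2)).toReal :=
    (ENNReal.ofReal_le_iff_le_toReal htop).1 hWge
  linarith

/-- Criticality of the Filippas–Tertikas–Tidblom operator when `α_n = 0` (Theorem 7.2):
if `α₁, …, α_n` are nonpositive, `α_n = 0`, and `α₁, …, α_{n-1}` are either pairwise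
distinct or all strictly negative, then for every measurable weight `W : ℝⁿ₊ → [0,∞]`
positive on a set of positive measure there is a test function `φ` with
`∫ |∇φ|² < ∫ (V + W) φ²`. -/
theorem ftt_critical {n : ℕ} [NeZero n] (hn : 2 ≤ n) (α β : Fin n → ℝ)
    (hα : ∀ i, α i ≤ 0) (hαn : α ⟨n - 1, by omega⟩ = 0)
    (hd : (∀ i j : Fin n, (i : ℕ) < n - 1 → (j : ℕ) < n - 1 → i ≠ j → α i ≠ α j) ∨
      (∀ i : Fin n, (i : ℕ) < n - 1 → α i < 0))
    (hβ0 : β 0 = 1 / 4 - (α 0) ^ 2)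
    (hβ : ∀ i : Fin n, 0 < (i : ℕ) → β i = (α (i - 1) - 1 / 2) ^ 2 - (α i) ^ 2)
    (W : EuclideanSpace ℝ (Fin n) → ℝ≥0∞) (hW : Measurable W)
    (hWpos : 0 < volume {x | x ∈ Hplus n ∧ 0 < W x}) :
    ∃ φ : EuclideanSpace ℝ (Fin n) → ℝ, IsTestFun (Hplus n) φ ∧
      ((∫⁻ x in Hplus n, W x * ENNReal.ofReal ((φ x) ^ 2)) = ⊤ ∨
        (∫ x in Hplus n, ‖gradient φ x‖ ^ 2) <
          (∫ x in Hplus n,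
              (∑ i : Fin n, β i / (∑ j ∈ Finset.Iic i, (x j) ^ 2)) * (φ x) ^ 2)
            + (∫⁻ x in Hplus n, W x * ENNReal.ofReal ((φ x) ^ 2)).toReal) := by
  obtain ⟨m, rfl⟩ : ∃ m, n = m + 1 := ⟨n - 1, by omega⟩
  set a : ℕ → ℝ := fun i => if h : i < m + 1 then α ⟨i, h⟩ else 0 with ha
  set b : ℕ → ℝ := fun i => if h : i < m + 1 then β ⟨i, h⟩ else 0 with hb
  have haf : ∀ i : Fin (m + 1), a i = α i := fun i => by simp only [ha]; rw [dif_pos i.2]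
  have hbf : ∀ i : Fin (m + 1), b i = β i := fun i => by simp only [hb]; rw [dif_pos i.2]
  have hV : ∀ x : EuclideanSpace ℝ (Fin (m + 1)),
      (∑ i : Fin (m + 1), β i / (∑ j ∈ Finset.Iic i, (x j) ^ 2)) = VV (m := m) b x := by
    intro x
    unfold VV
    rw [← Fin.sum_univ_eq_sum_range (fun i => b i / RR (m := m) i x) (m + 1)]
    refine Finset.sum_congr rfl fun i _ => ?_
    rw [hbf]
    congr 1
    simp only [RR, Qs]
    rw [← Finset.sum_filter]
    refine Finset.sum_congr ?_ fun _ _ => rfl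
    ext j
    rw [Finset.mem_Iic, Finset.mem_filter]
    exact ⟨fun h => ⟨Finset.mem_univ _, h⟩, fun h => h.2⟩
  simp only [hV]
  refine main_aux m a b ?_ ?_ ?_ ?_ W hW hWpos
  · intro i
    simp only [ha]
    split_ifs
    · exact hα _
    · exact le_rfl
  · simp only [ha]
    rw [dif_pos (Nat.lt_succ_self m)]
    exact hαn
  · have h1 := haf 0
    have h2 := hbf 0
    simp only [Fin.val_zero] at h1 h2
    rw [h1, h2]
    exact hβ0
  · intro i hi
    have h1 : b (i + 1) = β ⟨i + 1, by omega⟩ := hbf ⟨i + 1, by omega⟩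
    have h2 : a (i + 1) = α ⟨i + 1, by omega⟩ := haf ⟨i + 1, by omega⟩
    have h3 : a i = α ⟨i, by omega⟩ := haf ⟨i, by omega⟩
    rw [h1, h2, h3, hβ ⟨i + 1, by omega⟩ (Nat.succ_pos i)]
    congr 4
    have hm : 1 ≤ m := by omega
    ext
    rw [Fin.sub_val_of_le]
    · have : ((1 : Fin (m + 1)) : ℕ) = 1 := by
        rw [Fin.val_one']
        exact Nat.mod_eq_of_lt (by omega)
      simp only [this]; omega
    · rw [Fin.le_def, Fin.val_one', Nat.mod_eq_of_lt (by omega)]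
      simp
end
end

section
/- Weighted square-integrability of the spherical profile (key integrability claim (7.6) in the proof of Lemma 7.3): let n ≥ 2, let α₁, …, α_{n−1} be nonpositive real numbers that are either pairwise distinct or all strictly negative, and define γ₁ := α₁ − 1/2 and γ_i := α_i − α_{i−1} + 1/2 for 2 ≤ i ≤ n−1. Let S₊ := {ω ∈ S^{n−1} : ω₁ > 0} and define Φ : S₊ → ℝ by Φ(ω) := ω₁^{−γ₁} ∏_{k=2}^{n−1} (ω₁² + ⋯ + ω_k²)^{−γ_k/2} (for n = 2 the product is empty and Φ(ω) = ω₁^{−γ₁}). Then ∫_{S₊ ∩ {ω₁ ≤ 1/2}} Φ(ω)² / (ω₁ log ω₁)² dH^{n−1}(ω) < ∞, where H^{n−1} is the (n−1)-dimensional Hausdorff measure on the unit sphere. -/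
open MeasureTheory
noncomputable section

lemma aux_abs (f : ℝ → ENNReal) : ∫⁻ x, f |x| ≤ 2 * ∫⁻ x in Set.Ioi 0, f x := by
  have h1 : ∫⁻ x in Set.Ioi 0, f |x| = ∫⁻ x in Set.Ioi 0, f x :=
    setLIntegral_congr_fun measurableSet_Ioi (fun x hx => by
      simp only [abs_of_pos (Set.mem_Ioi.1 hx)])
  have h2 : ∫⁻ x in Set.Iio 0, f |x| = ∫⁻ x in Set.Ioi 0, f x := by
    rw [← h1]
    have := (Measure.measurePreserving_neg (volume : Measure ℝ)).setLIntegral_comp_preimage_emb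
      (MeasurableEquiv.neg ℝ).measurableEmbedding (fun x => f |x|) (Set.Ioi 0)
    rw [← this]
    simp
  have h3 : ∫⁻ x, f |x| = ∫⁻ x in Set.Iio 0 ∪ Set.Ici 0, f |x| := by
    rw [Set.Iio_union_Ici]; simp
  rw [h3]
  refine (lintegral_union_le _ _ _).trans ?_
  rw [h2, setLIntegral_congr Ioi_ae_eq_Ici.symm, h1, two_mul]

lemma aux_rpow {b r : ℝ} (hb : 0 < b) (hr : 0 ≤ r) :
    ∫⁻ x : ℝ, (if |x| ≤ r then ENNReal.ofReal (|x| ^ (b - 1)) else 0)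
      ≤ 2 * ENNReal.ofReal (r ^ b / b) := by
  refine (aux_abs (fun x => if x ≤ r then ENNReal.ofReal (x ^ (b - 1)) else 0)).trans ?_
  gcongr
  have : ∫⁻ x in Set.Ioi 0, (if x ≤ r then ENNReal.ofReal (x ^ (b - 1)) else 0)
      = ∫⁻ x in Set.Ioc 0 r, ENNReal.ofReal (x ^ (b - 1)) := by
    have h : (fun x : ℝ => if x ≤ r then ENNReal.ofReal (x ^ (b - 1)) else 0)
      = (Set.Iic r).indicator (fun x => ENNReal.ofReal (x ^ (b - 1))) := by
      ext x; simp [Set.indicator]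
    rw [h, lintegral_indicator measurableSet_Iic, Measure.restrict_restrict measurableSet_Iic,
      Set.inter_comm, Set.Ioi_inter_Iic]
  rw [this, ← ofReal_integral_eq_lintegral_ofReal]
  · rw [← intervalIntegral.integral_of_le hr, integral_rpow (Or.inl (by linarith))]
    simp [Real.zero_rpow hb.ne']
  · have := intervalIntegral.intervalIntegrable_rpow' (a := 0) (b := r) (r := b - 1) (by linarith)
    exact (intervalIntegrable_iff_integrableOn_Ioc_of_le hr).1 this
  · filter_upwards [ae_restrict_mem measurableSet_Ioc] with x hx
    exact Real.rpow_nonneg hx.1.le _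

def hh (b t x : ℝ) : ENNReal :=
  (if |x| ≤ 1 then ENNReal.ofReal (|x| ^ (b - 1)) else 0) +
    ENNReal.ofReal (|t| ^ (-b)) * (if |x| ≤ |t| then ENNReal.ofReal (|x| ^ (b - 1)) else 0)

def gg (t : ℝ) : ENNReal :=
  if |t| ≤ 1 then ENNReal.ofReal (|t|⁻¹ * (Real.log (min |t| (1 / 2)) ^ 2)⁻¹) else 0

lemma hh_int {b : ℝ} (hb : 0 < b) (t : ℝ) :
    ∫⁻ x, hh b t x ≤ 4 * ENNReal.ofReal (1 / b) := by
  unfold hh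
  rw [lintegral_add_left (by
    refine Measurable.ite (measurableSet_le (by fun_prop) (by fun_prop)) (by fun_prop)
      (by fun_prop))]
  rw [lintegral_const_mul _ (by
    refine Measurable.ite (measurableSet_le (by fun_prop) (by fun_prop)) (by fun_prop)
      (by fun_prop))]
  have h1 := aux_rpow (r := 1) hb zero_le_one
  have h2 := aux_rpow (r := |t|) hb (abs_nonneg t)
  have h3 : ENNReal.ofReal (|t| ^ (-b)) * (2 * ENNReal.ofReal (|t| ^ b / b))
      ≤ 2 * ENNReal.ofReal (1 / b) := by
    rw [mul_left_comm, ← ENNReal.ofReal_mul (by positivity)]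
    gcongr
    rw [← mul_div_assoc]
    gcongr
    rcases eq_or_ne t 0 with rfl | ht
    · simp [Real.zero_rpow hb.ne']
    · rw [← Real.rpow_add (by positivity)]; simp
  calc _ ≤ 2 * ENNReal.ofReal (1 ^ b / b) + 2 * ENNReal.ofReal (1 / b) :=
        add_le_add h1 ((mul_le_mul_right h2 _).trans h3)
    _ = _ := by rw [Real.one_rpow]; ring

lemma gg_int : ∫⁻ t, gg t < ⊤ := by
  refine (aux_abs (fun t => if t ≤ 1 then
    ENNReal.ofReal (t⁻¹ * (Real.log (min t (1 / 2)) ^ 2)⁻¹) else 0)).trans_lt ?_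
  refine ENNReal.mul_lt_top (by simp) ?_
  have h : (fun t : ℝ => if t ≤ 1 then
      ENNReal.ofReal (t⁻¹ * (Real.log (min t (1 / 2)) ^ 2)⁻¹) else 0)
      = (Set.Iic 1).indicator
        (fun t => ENNReal.ofReal (t⁻¹ * (Real.log (min t (1 / 2)) ^ 2)⁻¹)) := by
    ext x; simp [Set.indicator]
  rw [h, lintegral_indicator measurableSet_Iic, Measure.restrict_restrict measurableSet_Iic,
    Set.inter_comm, Set.Ioi_inter_Iic]
  suffices IntegrableOn (fun t : ℝ => t⁻¹ * (Real.log (min t (1 / 2)) ^ 2)⁻¹) (Set.Ioc 0 1) by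
    have h := this.lintegral_lt_top
    exact h
  have hu : Set.Ioc (0:ℝ) 1 = Set.Ioc 0 (1/2) ∪ Set.Ioc (1/2) 1 := by
    rw [Set.Ioc_union_Ioc_eq_Ioc] <;> norm_num
  rw [hu]
  refine IntegrableOn.union ?_ ?_
  · have : IntegrableOn (fun t : ℝ => t⁻¹ * (Real.log t ^ 2)⁻¹) (Set.Ioc 0 (1/2)) := by
      refine intervalIntegral.integrableOn_deriv_of_nonneg (g := fun t => -(Real.log t)⁻¹) ?_ ?_ ?_
      · intro t ht
        rcases eq_or_lt_of_le ht.1 with rfl | h0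
        · have : Filter.Tendsto (fun t : ℝ => -(Real.log t)⁻¹) (nhdsWithin 0 {0}ᶜ) (nhds 0) := by
            have := (tendsto_inv_atBot_zero.comp Real.tendsto_log_nhdsNE_zero).neg
            simpa using this
          have : ContinuousAt (fun t : ℝ => -(Real.log t)⁻¹) 0 := by
            rw [continuousAt_iff_punctured_nhds]
            simpa using this
          exact this.continuousWithinAt
        · have : Real.log t < 0 := Real.log_neg h0 (by linarith [ht.2])
          exact ((Real.continuousAt_log h0.ne').inv₀ this.ne).neg.continuousWithinAt
      · intro t ht
        have : Real.log t < 0 := Real.log_neg ht.1 (by linarith [ht.2])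
        have h := ((Real.hasDerivAt_log ht.1.ne').inv this.ne).neg
        rw [neg_div, neg_neg, div_eq_mul_inv] at h
        exact h
      · intro t ht
        have := ht.1
        positivity
    refine this.congr_fun (fun t ht => ?_) measurableSet_Ioc
    simp only [min_eq_left ht.2]
  · have : IntegrableOn (fun t : ℝ => t⁻¹ * (Real.log (1/2) ^ 2)⁻¹) (Set.Icc (1/2) 1) := by
      refine ContinuousOn.integrableOn_Icc ?_
      refine ContinuousOn.mul (ContinuousOn.inv₀ continuousOn_id ?_) continuousOn_const
      intro t ht
      have := ht.1
      linarith
    refine (this.mono_set Set.Ioc_subset_Icc_self).congr_fun (fun t ht => ?_) measurableSet_Ioc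
    simp only [min_eq_right ht.1.le]

lemma hh_meas (b : ℝ) : Measurable (fun p : ℝ × ℝ => hh b p.1 p.2) := by
  unfold hh
  refine Measurable.add ?_ (Measurable.mul (by fun_prop) ?_)
  · exact Measurable.ite (measurableSet_le (by fun_prop) (by fun_prop)) (by fun_prop) (by fun_prop)
  · exact Measurable.ite (measurableSet_le (by fun_prop) (by fun_prop)) (by fun_prop) (by fun_prop)

lemma gg_meas : Measurable gg := by
  unfold gg
  exact Measurable.ite (measurableSet_le (by fun_prop) (by fun_prop)) (by fun_prop) (by fun_prop)

lemma prod_int (e : ℕ) (f : ℝ → ENNReal) (hf : Measurable f) :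
    ∫⁻ x : Fin e → ℝ, ∏ k, f (x k) = (∫⁻ x, f x) ^ e := by
  induction e with
  | zero =>
    rw [volume_pi, Measure.pi_of_empty]
    simp
  | succ e ih =>
    have hp := volume_preserving_piFinSuccAbove (fun _ : Fin (e + 1) => ℝ) 0
    have h1 : ∫⁻ x : Fin (e + 1) → ℝ, ∏ k, f (x k)
        = ∫⁻ p : ℝ × (Fin e → ℝ), f p.1 * ∏ k, f (p.2 k) := by
      rw [← hp.lintegral_comp_emb (MeasurableEquiv.measurableEmbedding _)]
      refine lintegral_congr fun x => ?_
      rw [Fin.prod_univ_succ]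
      rfl
    rw [h1, Measure.volume_eq_prod, lintegral_prod_mul (g := fun y : Fin e → ℝ => ∏ k, f (y k))
      hf.aemeasurable (Finset.measurable_prod _ fun k _ =>
        hf.comp (measurable_pi_apply k)).aemeasurable, ih, pow_succ']

def WW (e : ℕ) (b : ℝ) (i : Fin (e + 1)) (y : Fin (e + 1) → ℝ) : ENNReal :=
  gg (y i) * ∏ k : Fin e, hh b (y i) (y (i.succAbove k))

lemma WW_meas (e : ℕ) (b : ℝ) (i : Fin (e + 1)) : Measurable (WW e b i) := by
  unfold WW
  refine Measurable.mul (gg_meas.comp (measurable_pi_apply i)) ?_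
  refine Finset.measurable_prod _ fun k _ => ?_
  have h : Measurable (fun y : Fin (e + 1) → ℝ => (y i, y (i.succAbove k))) := by fun_prop
  exact (hh_meas b).comp h

lemma WW_int (e : ℕ) {b : ℝ} (hb : 0 < b) (i : Fin (e + 1)) :
    ∫⁻ y, WW e b i y < ⊤ := by
  have hp := volume_preserving_piFinSuccAbove (fun _ : Fin (e + 1) => ℝ) i
  have hm : Measurable (fun p : ℝ × (Fin e → ℝ) => gg p.1 * ∏ k, hh b p.1 (p.2 k)) := by
    refine Measurable.mul (gg_meas.comp measurable_fst) ?_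
    refine Finset.measurable_prod _ fun k _ => ?_
    exact (hh_meas b).comp (measurable_fst.prodMk
      ((measurable_pi_apply k).comp measurable_snd))
  have h1 : ∫⁻ y, WW e b i y
      = ∫⁻ p : ℝ × (Fin e → ℝ), gg p.1 * ∏ k, hh b p.1 (p.2 k) := by
    rw [← hp.lintegral_comp_emb (MeasurableEquiv.measurableEmbedding _)]
    rfl
  rw [h1, Measure.volume_eq_prod, lintegral_prod _ hm.aemeasurable]
  have h2 : ∀ t, ∫⁻ z : Fin e → ℝ, gg t * ∏ k, hh b t (z k)
      ≤ gg t * (4 * ENNReal.ofReal (1 / b)) ^ e := by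
    intro t
    have ht : Measurable (hh b t) := (hh_meas b).comp measurable_prodMk_left
    rw [lintegral_const_mul _ (by fun_prop), prod_int e _ ht]
    gcongr
    exact hh_int hb t
  refine (lintegral_mono h2).trans_lt ?_
  rw [lintegral_mul_const _ gg_meas]
  refine ENNReal.mul_lt_top gg_int ?_
  exact ENNReal.pow_lt_top (ENNReal.mul_lt_top (by simp) (by simp))

/-- Chart estimate for the Hausdorff measure on a cap of the sphere. -/
lemma chart_le (d : ℕ) (m : Fin (d + 1)) (c s : ℝ) (hc : 0 < c) (hs : |s| = 1)
    (S : Set (EuclideanSpace ℝ (Fin (d + 1))))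
    (hS1 : ∀ ω ∈ S, ω ∈ Metric.sphere (0 : EuclideanSpace ℝ (Fin (d + 1))) 1)
    (hS2 : ∀ ω ∈ S, c ≤ s * ω m) :
    ∃ K : NNReal, Measure.map (fun (ω : EuclideanSpace ℝ (Fin (d + 1))) (k : Fin d) => ω (m.succAbove k))
      ((Measure.hausdorffMeasure (d : ℝ)).restrict S) ≤ (K : ENNReal) ^ (d : ℝ) • volume := by
  set π := fun (ω : EuclideanSpace ℝ (Fin (d + 1))) (k : Fin d) => ω (m.succAbove k) with hπ
  have hπm : Measurable π := by fun_prop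
  have hsq : ∀ ω ∈ S, ω m ^ 2 + ∑ k, (π ω k) ^ 2 = 1 := by
    intro ω hω
    have := hS1 ω hω
    rw [mem_sphere_zero_iff_norm] at this
    have h2 := EuclideanSpace.real_norm_sq_eq ω
    rw [this, Fin.sum_univ_succAbove _ m] at h2
    simpa using h2.symm
  have hle : ∀ ω ∈ S, ∀ k, |π ω k| ≤ 1 := by
    intro ω hω k
    have h := hsq ω hω
    have h2 := Finset.single_le_sum (f := fun k => (π ω k) ^ 2) (fun i _ => sq_nonneg _)
      (Finset.mem_univ k)
    rw [← sq_le_one_iff_abs_le_one]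
    have := sq_nonneg (ω m)
    simp only at h2
    linarith
  let K : NNReal := ⟨d / c + d, by positivity⟩
  have hK : ∀ x ∈ S, ∀ y ∈ S, dist x y ≤ K * dist (π x) (π y) := by
    intro x hx y hy
    set D := dist (π x) (π y) with hD
    have hD0 : 0 ≤ D := dist_nonneg
    have hcomp : ∀ k, |π x k - π y k| ≤ D := fun k => by
      rw [← Real.dist_eq]; exact dist_le_pi_dist _ _ k
    have hm : |x m - y m| ≤ d / c * D := by
      have h1 : (x m - y m) * (x m + y m) = - ∑ k, (π x k - π y k) * (π x k + π y k) := by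
        have e1 := hsq x hx
        have e2 := hsq y hy
        have : ∑ k, (π x k - π y k) * (π x k + π y k)
          = ∑ k, (π x k) ^ 2 - ∑ k, (π y k) ^ 2 := by
          rw [← Finset.sum_sub_distrib]; exact Finset.sum_congr rfl fun k _ => by ring
        rw [this]; linarith [e1, e2, (by ring : (x m - y m) * (x m + y m) = x m ^ 2 - y m ^ 2)]
      have h2 : |x m - y m| * |x m + y m| ≤ ∑ k : Fin d, D * 2 := by
        rw [← abs_mul, h1, abs_neg]
        refine (Finset.abs_sum_le_sum_abs _ _).trans (Finset.sum_le_sum fun k _ => ?_)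
        rw [abs_mul]
        refine mul_le_mul (hcomp k) ?_ (abs_nonneg _) hD0
        refine (abs_add_le _ _).trans ?_
        linarith [hle x hx k, hle y hy k]
      have h3 : 2 * c ≤ |x m + y m| := by
        have : |x m + y m| = |s * (x m + y m)| := by rw [abs_mul, hs, one_mul]
        rw [this]
        refine le_trans ?_ (le_abs_self _)
        linarith [hS2 x hx, hS2 y hy]
      have h4 : |x m - y m| * (2 * c) ≤ d * (D * 2) := by
        refine (mul_le_mul_of_nonneg_left h3 (abs_nonneg _)).trans ?_
        simpa using h2
      rw [div_mul_eq_mul_div, le_div_iff₀ hc]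
      linarith
    have hn : dist x y ≤ ∑ j, |x j - y j| := by
      rw [EuclideanSpace.dist_eq]
      rw [Real.sqrt_le_left (Finset.sum_nonneg fun _ _ => abs_nonneg _)]
      simp only [Real.dist_eq]
      exact Finset.sum_sq_le_sq_sum_of_nonneg fun i _ => abs_nonneg _
    rw [Fin.sum_univ_succAbove _ m] at hn
    have hn2 : ∑ k : Fin d, |x (m.succAbove k) - y (m.succAbove k)| ≤ d * D := by
      refine (Finset.sum_le_sum fun k _ => hcomp k).trans ?_
      simp
    calc dist x y ≤ _ := hn
      _ ≤ d / c * D + d * D := add_le_add hm hn2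
      _ = (d / c + d) * D := by ring
      _ = K * D := rfl
  have hinj : Set.InjOn π S := by
    intro x hx y hy hxy
    have := hK x hx y hy
    rw [hxy, dist_self, mul_zero] at this
    exact dist_le_zero.1 this
  refine ⟨K, Measure.le_iff.2 fun A hA => ?_⟩
  rw [Measure.map_apply hπm hA, Measure.restrict_apply (hπm hA)]
  set B := π ⁻¹' A ∩ S with hB
  let g := Function.invFunOn π S
  have hg : ∀ x ∈ S, g (π x) = x := fun x hx => hinj.leftInvOn_invFunOn hx
  have hgl : LipschitzOnWith K g (π '' B) := by
    refine LipschitzOnWith.of_dist_le_mul ?_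
    rintro _ ⟨x, hx, rfl⟩ _ ⟨y, hy, rfl⟩
    rw [hg x hx.2, hg y hy.2]
    exact hK x hx.2 y hy.2
  have himg : g '' (π '' B) = B := by
    ext z
    constructor
    · rintro ⟨_, ⟨x, hx, rfl⟩, rfl⟩
      rw [hg x hx.2]; exact hx
    · intro hz
      exact ⟨π z, ⟨z, hz, rfl⟩, hg z hz.2⟩
  have h1 := hgl.hausdorffMeasure_image_le (d := d) (by positivity)
  rw [himg] at h1
  refine h1.trans ?_
  rw [Measure.smul_apply, smul_eq_mul]
  gcongr
  have h2 : (Measure.hausdorffMeasure (d : ℝ) : Measure (Fin d → ℝ)) = volume := by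
    have := hausdorffMeasure_pi_real (ι := Fin d)
    simpa using this
  rw [h2]
  rintro _ ⟨x, hx, rfl⟩
  exact hx.1

lemma expo_id (e : ℕ) (α γ : Fin (e + 1) → ℝ) (L : ℕ → ℝ) (hL : L (e + 1) = 0)
    (hγ0 : γ 0 = α 0 - 1 / 2)
    (hγ : ∀ c : Fin e, γ c.succ = α c.succ - α c.castSucc + 1 / 2) :
    2 * (-γ 0 * L 0 + ∑ c : Fin e, -γ c.succ * L (c + 1)) - 2 * L 0
      = ∑ c : Fin (e + 1), (-L c + (-2 * α c) * (L c - L (c + 1))) := by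
  have h1 : ∑ c : Fin (e + 1), (-L c + (-2 * α c) * (L c - L (c + 1)))
      = ∑ c : Fin (e + 1), (-L c + (-2 * α c) * L c)
        + ∑ c : Fin (e + 1), 2 * α c * L (c + 1) := by
    rw [← Finset.sum_add_distrib]
    exact Finset.sum_congr rfl fun c _ => by ring
  rw [h1, Fin.sum_univ_succ, Fin.sum_univ_castSucc (n := e) (fun c => 2 * α c * L (c + 1))]
  simp only [Fin.val_zero, Fin.val_succ, Fin.val_castSucc, Fin.val_last, hL]
  rw [hγ0]
  have h2 : ∑ c : Fin e, -γ c.succ * L (c + 1) * 2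
      = ∑ c : Fin e, (-L (c + 1) + (-2 * α c.succ) * L (c + 1))
        + ∑ c : Fin e, 2 * α c.castSucc * L (c + 1) := by
    rw [← Finset.sum_add_distrib]
    exact Finset.sum_congr rfl fun c _ => by rw [hγ]; ring
  rw [← Finset.sum_mul] at h2
  linarith

lemma expo_bound (e : ℕ) (L l : ℕ → ℝ) (a : Fin (e + 1) → ℝ) (hL : Monotone L)
    (hL0 : L (e + 1) = 0) (hl : ∀ k, k ≤ e + 1 → l k ≤ L k)
    (b : ℝ) (hb : 0 < b) (hb1 : b < 1) (j : Fin (e + 1)) (ha : ∀ k, 0 ≤ a k)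
    (ha' : ∀ k, k ≠ j → (e + 2) * b ≤ a k) (q : ℝ) (hq : 0 ≤ q) (hl0 : l 0 = L 0)
    (m : ℕ) (hm : 1 ≤ m) (hm' : m ≤ e + 1) (hlm : -q ≤ l m) :
    ∃ T : ℕ → ℝ, ∑ c : Fin (e + 1), (-L c + a c * (L c - L (c + 1)))
        ≤ ∑ k : Fin (e + 2), T k ∧ T m ≤ q ∧ ∃ i ≤ e + 1, i ≠ m ∧ l 0 ≤ l i ∧ T i ≤ -l i ∧
        ∀ k ≤ e + 1, T k ≤ q + (b - 1) * l k ∨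
          (l k ≤ l i ∧ T k ≤ q + ((b - 1) * l k - b * l i)) := by
  set D := (L 0 - L j) + L (j + 1) with hD
  have hj := j.2
  have hD1 : D ≤ L 0 - L j := by
    have : L (j + 1) ≤ L (e + 1) := hL (by omega)
    linarith
  have hD2 : D ≤ L (j + 1) := by
    have : L 0 ≤ L j := hL (by omega)
    linarith
  have hD0 : D ≤ 0 := by
    have : L 0 ≤ L j := hL (by omega)
    linarith
  have hE : ∑ c : Fin (e + 1), a c * (L c - L (c + 1)) ≤ (e + 2) * b * D := by
    have h1 : ∑ c : Fin (e + 1), (L c - L (c + 1)) = L 0 - L (e + 1) := by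
      rw [Fin.sum_univ_eq_sum_range (fun k => L k - L (k + 1)) (e + 1)]
      exact Finset.sum_range_sub' L (e + 1)
    have h2 : ∑ c : Fin (e + 1), (if c = j then 0 else L c - L (c + 1)) = D := by
      have : ∑ c : Fin (e + 1), (L c - L (c + 1))
        = ∑ c : Fin (e + 1), (if c = j then 0 else L c - L (c + 1))
          + ∑ c : Fin (e + 1), (if c = j then L c - L (c + 1) else 0) := by
        rw [← Finset.sum_add_distrib]
        exact Finset.sum_congr rfl fun c _ => by split_ifs <;> simp
      rw [h1, Finset.sum_ite_eq' Finset.univ j (fun c : Fin (e+1) => L c - L (c + 1))] at this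
      simp only [Finset.mem_univ, if_true] at this
      linarith
    rw [← h2, Finset.mul_sum]
    refine Finset.sum_le_sum fun c _ => ?_
    have h3 : L c ≤ L (c + 1) := hL (by omega)
    split_ifs with h
    · nlinarith [ha c]
    · nlinarith [ha' c h]
  refine ⟨fun k => -L k + b * D, ?_, ?_, ?_⟩
  · rw [Finset.sum_add_distrib, Finset.sum_add_distrib, Fin.sum_univ_castSucc (n := e + 1)]
    simp [hL0]
    linarith
  · have := hl m hm'
    simp only
    nlinarith
  · by_cases hmj : m ≤ j
    · refine ⟨0, by omega, by omega, le_rfl, ?_, fun k hk => Or.inl ?_⟩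
      · simp only; nlinarith
      · have h1 : -q ≤ L j := hlm.trans ((hl m hm').trans (hL hmj))
        have h2 : L 0 ≤ L k := hL (by omega)
        have h3 := hl k hk
        simp only
        have h4 : b * D ≤ b * (L k + q) := mul_le_mul_of_nonneg_left (by linarith) hb.le
        nlinarith
    · obtain ⟨i, hi, hmax⟩ := Finset.exists_max_image (Finset.range (j + 1)) l ⟨0, by simp⟩
      simp only [Finset.mem_range] at hi hmax
      refine ⟨i, by omega, by omega, hmax 0 (by omega), ?_, fun k hk => ?_⟩
      · have := hl i (by omega)
        simp only
        nlinarith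
      · have h3 := hl k hk
        by_cases hkj : k ≤ j
        · refine Or.inr ⟨hmax k (by omega), ?_⟩
          have h1 : L 0 ≤ L k := hL (by omega)
          have h2 : l i ≤ L j := (hl i (by omega)).trans (hL (by omega))
          have h4 : b * D ≤ b * (L k - l i) := mul_le_mul_of_nonneg_left (by linarith) hb.le
          simp only
          nlinarith
        · refine Or.inl ?_
          have h1 : L (j + 1) ≤ L k := hL (by omega)
          have h4 : b * D ≤ b * (L k) := mul_le_mul_of_nonneg_left (by linarith) hb.le
          simp only
          nlinarith

lemma exists_b (e : ℕ) (α : Fin (e + 1) → ℝ) (hα : ∀ i, α i ≤ 0)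
    (hd : Function.Injective α ∨ ∀ i, α i < 0) :
    ∃ j, ∃ b : ℝ, 0 < b ∧ b < 1 ∧ ∀ k, k ≠ j → (e + 2) * b ≤ -2 * α k := by
  have h1 : ∃ j, ∀ k, k ≠ j → α k < 0 := by
    rcases hd with hd | hd
    · by_cases h : ∃ j, α j = 0
      · obtain ⟨j, hj⟩ := h
        refine ⟨j, fun k hk => lt_of_le_of_ne (hα k) fun h0 => hk (hd (h0.trans hj.symm))⟩
      · push Not at h
        exact ⟨0, fun k _ => lt_of_le_of_ne (hα k) (h k)⟩
    · exact ⟨0, fun k _ => hd k⟩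
  obtain ⟨j, hj⟩ := h1
  obtain ⟨i, -, hi⟩ := Finset.exists_min_image Finset.univ
    (fun k => if k = j then (1 : ℝ) else -2 * α k) ⟨0, by simp⟩
  set A := (if i = j then (1 : ℝ) else -2 * α i) with hA
  have hA0 : 0 < A := by
    rw [hA]; split_ifs with h
    · exact one_pos
    · linarith [hj i h]
  have hA1 : A ≤ 1 := by simpa using hi j (by simp)
  refine ⟨j, A / (e + 2), by positivity, ?_, fun k hk => ?_⟩
  · rw [div_lt_one (by positivity)]
    have : (0:ℝ) ≤ e := by positivity
    linarith
  · have := hi k (by simp)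
    simp only [hk, if_false] at this
    rw [mul_div_cancel₀ _ (by positivity)]
    exact this

lemma gg_bound {t u T : ℝ} (ht : t ≠ 0) (ht1 : |t| ≤ 1) (hu : 0 < u) (hu1 : u ≤ 1 / 2)
    (hut : Real.log u ≤ Real.log |t|) (hT : T ≤ -Real.log |t|) :
    ENNReal.ofReal (Real.exp T / Real.log u ^ 2) ≤ gg t := by
  rw [gg, if_pos ht1]
  refine ENNReal.ofReal_le_ofReal ?_
  rw [div_eq_mul_inv]
  have htp : 0 < |t| := abs_pos.2 ht
  have hut' : u ≤ |t| := (Real.log_le_log_iff hu htp).1 hut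
  have h1 : Real.exp T ≤ |t|⁻¹ := by
    rw [← Real.exp_log htp, ← Real.exp_neg]
    exact Real.exp_le_exp.2 hT
  have hmin : 0 < min |t| (1 / 2) := lt_min htp (by norm_num)
  have h2 : Real.log u ≤ Real.log (min |t| (1 / 2)) :=
    Real.log_le_log hu (le_min hut' hu1)
  have h3 : Real.log (min |t| (1 / 2)) < 0 :=
    Real.log_neg hmin ((min_le_right _ _).trans_lt (by norm_num))
  have h4 : Real.log (min |t| (1 / 2)) ^ 2 ≤ Real.log u ^ 2 := by nlinarith
  have h5 : 0 < Real.log (min |t| (1 / 2)) ^ 2 := sq_pos_of_neg h3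
  gcongr

lemma hh_bound {b t x q T : ℝ} (ht : t ≠ 0) (hx : x ≠ 0) (hx1 : |x| ≤ 1)
    (h : T ≤ q + (b - 1) * Real.log |x| ∨ (Real.log |x| ≤ Real.log |t| ∧
      T ≤ q + ((b - 1) * Real.log |x| - b * Real.log |t|))) :
    ENNReal.ofReal (Real.exp T) ≤ ENNReal.ofReal (Real.exp q) * hh b t x := by
  have htp : 0 < |t| := abs_pos.2 ht
  have hxp : 0 < |x| := abs_pos.2 hx
  rcases h with h | ⟨h1, h⟩
  · refine le_trans ?_ (mul_le_mul_right (self_le_add_right _ _) _)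
    rw [if_pos hx1, ← ENNReal.ofReal_mul (Real.exp_pos _).le]
    refine ENNReal.ofReal_le_ofReal ?_
    rw [Real.rpow_def_of_pos hxp, ← Real.exp_add]
    exact Real.exp_le_exp.2 (by linarith)
  · refine le_trans ?_ (mul_le_mul_right (self_le_add_left _ _) _)
    rw [if_pos ((Real.log_le_log_iff hxp htp).1 h1),
      ← ENNReal.ofReal_mul (by positivity), ← ENNReal.ofReal_mul (Real.exp_pos _).le]
    refine ENNReal.ofReal_le_ofReal ?_
    rw [Real.rpow_def_of_pos hxp, Real.rpow_def_of_pos htp, ← Real.exp_add, ← Real.exp_add]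
    exact Real.exp_le_exp.2 (by linarith)

lemma pointwise_bound (e : ℕ) (α γ : Fin (e + 1) → ℝ) (hα : ∀ i, α i ≤ 0)
    (hγ0 : γ 0 = α 0 - 1 / 2)
    (hγ : ∀ c : Fin e, γ c.succ = α c.succ - α c.castSucc + 1 / 2)
    (j : Fin (e + 1)) (b : ℝ) (hb : 0 < b) (hb1 : b < 1)
    (hj : ∀ k, k ≠ j → (e + 2) * b ≤ -2 * α k)
    (x : Fin (e + 2) → ℝ) (hx : ∑ k, x k ^ 2 = 1) (h0 : 0 < x 0) (h0' : x 0 ≤ 1 / 2)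
    (hne : ∀ k, x k ≠ 0) (m : Fin (e + 2)) (hm : m ≠ 0) (c : ℝ) (hc : 0 < c) (hc1 : c ≤ 1)
    (hcm : c ≤ |x m|) :
    ENNReal.ofReal
        (((x 0 ^ (-(γ 0))) *
            ∏ c ∈ Finset.univ.filter (fun c : Fin (e + 1) => 0 < (c : ℕ)),
              (∑ j ∈ Finset.univ.filter (fun j : Fin (e + 2) => (j : ℕ) ≤ (c : ℕ)),
                  (x j) ^ 2) ^ (-(γ c) / 2)) ^ 2 /
          (x 0 * Real.log (x 0)) ^ 2)
      ≤ ENNReal.ofReal (Real.exp (-Real.log c)) ^ (e + 1) *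
        ∑ i, WW e b i (fun k => x (m.succAbove k)) := by
  set R : ℕ → ℝ := fun k => ∑ j ∈ Finset.univ.filter (fun j : Fin (e + 2) => (j : ℕ) ≤ k),
                  (x j) ^ 2 with hR
  have hRm : Monotone R := by
    intro k k' hk
    refine Finset.sum_le_sum_of_subset_of_nonneg ?_ fun _ _ _ => sq_nonneg _
    intro i hi
    simp only [Finset.mem_filter, Finset.mem_univ, true_and] at hi ⊢
    omega
  have hRx : ∀ k : Fin (e + 2), x k ^ 2 ≤ R k := by
    intro k
    exact Finset.single_le_sum (f := fun j => x j ^ 2) (fun _ _ => sq_nonneg _)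
      (by simp)
  have hR0 : R 0 = x 0 ^ 2 := by
    have : (Finset.univ.filter (fun j : Fin (e + 2) => (j : ℕ) ≤ 0)) = {0} := by
      ext i
      simp
    simp only [hR, this, Finset.sum_singleton]
  have hRpos : ∀ k, 0 < R k := fun k => by
    have : R 0 ≤ R k := hRm (Nat.zero_le _)
    have : 0 < R 0 := by rw [hR0]; positivity
    linarith
  have hRe : R (e + 1) = 1 := by
    rw [← hx]
    refine Finset.sum_congr ?_ fun _ _ => rfl
    ext i
    simp
    omega
  set L : ℕ → ℝ := fun k => Real.log (R k) / 2 with hLdef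
  have hLm : Monotone L := fun k k' h => by
    simp only [hLdef]
    have := Real.log_le_log (hRpos k) (hRm h)
    linarith
  have hLe : L (e + 1) = 0 := by simp [hLdef, hRe]
  have hL0 : L 0 = Real.log (x 0) := by
    simp only [hLdef, hR0, Real.log_pow]; push_cast; ring
  set l : ℕ → ℝ := fun k => if h : k < e + 2 then Real.log |x ⟨k, h⟩| else 0 with hldef
  have hlx : ∀ k : Fin (e + 2), l k = Real.log |x k| := fun k => by simp [hldef]
  have hlL : ∀ k, k ≤ e + 1 → l k ≤ L k := by
    intro k hk
    have h := hRx ⟨k, by omega⟩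
    have h2 := hlx ⟨k, by omega⟩
    simp only at h h2
    rw [h2, hLdef]
    have h3 := Real.log_le_log (by have := hne ⟨k, by omega⟩; positivity) h
    rw [Real.log_pow, ← Real.log_abs] at h3
    push_cast at h3
    simp only
    linarith
  have hx1 : ∀ k, |x k| ≤ 1 := by
    intro k
    rw [← sq_le_one_iff_abs_le_one, ← hx]
    exact Finset.single_le_sum (f := fun j => x j ^ 2) (fun _ _ => sq_nonneg _) (by simp)
  have hl0 : l 0 = L 0 := by
    have := hlx 0
    rw [hL0]
    simpa [abs_of_pos h0] using this
  have hq : 0 ≤ -Real.log c := by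
    have := Real.log_nonpos hc.le hc1
    linarith
  have hmv : (m : ℕ) ≠ 0 := fun h => hm (Fin.ext h)
  obtain ⟨T, hE, hTm, i, hi, him, hi0, hTi, hTk⟩ := expo_bound e L l (fun k => -2 * α k) hLm hLe
    hlL b hb hb1 j (fun k => by linarith [hα k]) hj (-Real.log c) hq hl0 m (by omega) (by omega)
    (by rw [hlx, neg_neg]; exact Real.log_le_log hc hcm)
  have hmne : (⟨i, by omega⟩ : Fin (e + 2)) ≠ m := fun h => him (by rw [← h])
  obtain ⟨i', hi'⟩ := Fin.exists_succAbove_eq hmne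
  have hiv : ((m.succAbove i' : Fin (e + 2)) : ℕ) = i := by rw [hi']
  have hI : ((x 0 ^ (-(γ 0))) *
            ∏ c ∈ Finset.univ.filter (fun c : Fin (e + 1) => 0 < (c : ℕ)),
              (R c) ^ (-(γ c) / 2)) ^ 2 / (x 0 * Real.log (x 0)) ^ 2
      = Real.exp (∑ c : Fin (e + 1), (-L c + (-2 * α c) * (L c - L (c + 1))))
        / Real.log (x 0) ^ 2 := by
    rw [← expo_id e α γ L hLe hγ0 hγ]
    have h1 : x 0 ^ (-(γ 0)) = Real.exp (-γ 0 * L 0) := by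
      rw [Real.rpow_def_of_pos h0, hL0, mul_comm]
    have h2 : ∏ c ∈ Finset.univ.filter (fun c : Fin (e + 1) => 0 < (c : ℕ)),
              (R c) ^ (-(γ c) / 2) = Real.exp (∑ c : Fin e, -γ c.succ * L (c + 1)) := by
      rw [Real.exp_sum, Finset.prod_filter, Fin.prod_univ_succ]
      simp only [Fin.val_zero, lt_irrefl, if_false, one_mul, Fin.val_succ, Nat.succ_pos, if_true]
      refine Finset.prod_congr rfl fun c _ => ?_
      rw [Real.rpow_def_of_pos (hRpos _)]
      congr 1
      simp only [hLdef]
      ring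
    have h3 : x 0 ^ 2 = Real.exp (2 * L 0) := by
      rw [hL0, two_mul, Real.exp_add, Real.exp_log h0, sq]
    rw [h1, h2, ← Real.exp_add, mul_pow, h3, Real.exp_sub, ← div_div]
    congr 2
    rw [sq, ← Real.exp_add, ← two_mul]
  rw [hI]
  have hsum : ∑ k : Fin (e + 2), T k = T i + (T m + ∑ k : Fin e,
      T (m.succAbove (i'.succAbove k) : Fin (e + 2))) := by
    rw [Fin.sum_univ_succAbove _ m, Fin.sum_univ_succAbove _ i', hiv]
    ring
  set Q := ENNReal.ofReal (Real.exp (-Real.log c)) with hQ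
  have hxi : l i = Real.log |x (m.succAbove i')| := by rw [← hlx, hiv]
  calc _ ≤ ENNReal.ofReal (Real.exp (T i) / Real.log (x 0) ^ 2 * (Real.exp (T m) * ∏ k : Fin e,
        Real.exp (T (m.succAbove (i'.succAbove k) : Fin (e + 2))))) := by
        refine ENNReal.ofReal_le_ofReal ?_
        rw [div_mul_eq_mul_div, ← Real.exp_sum, ← Real.exp_add, ← Real.exp_add, ← hsum]
        gcongr
    _ = ENNReal.ofReal (Real.exp (T i) / Real.log (x 0) ^ 2) * (ENNReal.ofReal (Real.exp (T m)) *
        ∏ k : Fin e, ENNReal.ofReal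
          (Real.exp (T (m.succAbove (i'.succAbove k) : Fin (e + 2))))) := by
        rw [ENNReal.ofReal_mul (by positivity), ENNReal.ofReal_mul (by positivity),
          ENNReal.ofReal_prod_of_nonneg fun _ _ => (Real.exp_pos _).le]
    _ ≤ gg (x (m.succAbove i')) * (Q * ∏ k : Fin e, (Q * hh b (x (m.succAbove i'))
          (x (m.succAbove (i'.succAbove k))))) := by
        refine mul_le_mul' ?_ (mul_le_mul' ?_ (Finset.prod_le_prod' fun k _ => ?_))
        · refine gg_bound (hne _) (hx1 _) h0 h0' ?_ ?_
          · rw [← hxi, ← hL0, ← hl0]; exact hi0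
          · rw [← hxi]; exact hTi
        · exact ENNReal.ofReal_le_ofReal (Real.exp_le_exp.2 hTm)
        · refine hh_bound (hne _) (hne _) (hx1 _) ?_
          rw [← hxi, ← hlx]
          exact hTk _ (by omega)
    _ = Q ^ (e + 1) * WW e b i' (fun k => x (m.succAbove k)) := by
        rw [Finset.prod_mul_distrib, WW]
        simp only [Finset.prod_const, Finset.card_univ, Fintype.card_fin]
        ring
    _ ≤ _ := by
        gcongr
        exact Finset.single_le_sum (f := fun i => WW e b i (fun k => x (m.succAbove k)))
          (fun _ _ => zero_le) (Finset.mem_univ i')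

theorem ftt_profile_integrability {n : ℕ} (hn : 2 ≤ n) (α γ : Fin (n - 1) → ℝ)
    (hα : ∀ i, α i ≤ 0)
    (hd : Function.Injective α ∨ ∀ i, α i < 0)
    (hγ0 : γ ⟨0, by omega⟩ = α ⟨0, by omega⟩ - 1 / 2)
    (hγ : ∀ i : Fin (n - 1), 0 < (i : ℕ) → γ i = α i - α ⟨(i : ℕ) - 1, by omega⟩ + 1 / 2) :
    (∫⁻ ω in {ω : EuclideanSpace ℝ (Fin n) |
        ω ∈ Metric.sphere 0 1 ∧ 0 < ω ⟨0, by omega⟩ ∧ ω ⟨0, by omega⟩ ≤ 1 / 2},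
      ENNReal.ofReal
        (((ω ⟨0, by omega⟩ ^ (-(γ ⟨0, by omega⟩))) *
            ∏ c ∈ Finset.univ.filter (fun c : Fin (n - 1) => 0 < (c : ℕ)),
              (∑ j ∈ Finset.univ.filter (fun j : Fin n => (j : ℕ) ≤ (c : ℕ)),
                  (ω j) ^ 2) ^ (-(γ c) / 2)) ^ 2 /
          (ω ⟨0, by omega⟩ * Real.log (ω ⟨0, by omega⟩)) ^ 2)
      ∂(Measure.hausdorffMeasure ((n : ℝ) - 1))) < ⊤ := by
  obtain ⟨e, rfl⟩ : ∃ e, n = e + 2 := ⟨n - 2, by omega⟩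
  change Fin (e + 1) → ℝ at α γ
  have hdim : (((e + 2 : ℕ) : ℝ) - 1) = ((e + 1 : ℕ) : ℝ) := by push_cast; ring
  rw [hdim]
  obtain ⟨j, b, hb, hb1, hj⟩ := exists_b e α hα hd
  have hγ' : ∀ c : Fin e, γ c.succ = α c.succ - α c.castSucc + 1 / 2 := fun c =>
    hγ c.succ (by simp)
  set S : Set (EuclideanSpace ℝ (Fin (e + 2))) := {ω | ω ∈ Metric.sphere 0 1 ∧
    0 < ω ⟨0, by omega⟩ ∧ ω ⟨0, by omega⟩ ≤ 1 / 2} with hS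
  have hSm : MeasurableSet S := by
    have h0 : Measurable fun ω : EuclideanSpace ℝ (Fin (e + 2)) => ω ⟨0, by omega⟩ := by fun_prop
    exact Metric.isClosed_sphere.measurableSet.inter
      ((measurableSet_lt measurable_const h0).inter (measurableSet_le h0 measurable_const))
  set c : ℝ := 1 / (e + 2) with hc
  have hc0 : 0 < c := by positivity
  have hc1 : c ≤ 1 := by
    rw [hc, div_le_one (by positivity)]
    have : (0:ℝ) ≤ e := by positivity
    linarith
  have hsq : ∀ ω ∈ S, ∑ k, ω k ^ 2 = 1 := by
    intro ω hω
    have := hω.1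
    rw [mem_sphere_zero_iff_norm] at this
    have h2 := EuclideanSpace.real_norm_sq_eq ω
    rw [this] at h2
    simpa using h2.symm
  let P : Fin (e + 1) × Bool → Set (EuclideanSpace ℝ (Fin (e + 2))) := fun p =>
    S ∩ {ω | c ≤ (if p.2 then 1 else -1) * ω p.1.succ}
  have hPm : ∀ p, MeasurableSet (P p) := fun p =>
    hSm.inter (measurableSet_le (by fun_prop) (by fun_prop))
  have hcover : S ⊆ ⋃ p, P p := by
    intro ω hω
    by_contra hcon
    simp only [Set.mem_iUnion, not_exists] at hcon
    have hlt : ∀ k : Fin (e + 1), |ω k.succ| ≤ c := by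
      intro k
      have h1 := hcon (k, true)
      have h2 := hcon (k, false)
      simp only [P, Set.mem_inter_iff, hω, true_and, Set.mem_ofPred_eq, if_true, not_le] at h1 h2
      simp at h1 h2
      exact abs_le.2 ⟨by linarith, h1.le⟩
    have h1 := hsq ω hω
    rw [Fin.sum_univ_succ] at h1
    have h2 : ∑ k : Fin (e + 1), ω k.succ ^ 2 ≤ (e + 1) * c ^ 2 := by
      have : ∑ k : Fin (e + 1), ω k.succ ^ 2 ≤ ∑ k : Fin (e + 1), c ^ 2 :=
        Finset.sum_le_sum fun k _ => sq_le_sq' (abs_le.1 (hlt k)).1 (abs_le.1 (hlt k)).2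
      simpa using this
    have h3 : (e + 1) * c ^ 2 ≤ 1 / 4 := by
      rw [hc, div_pow, one_pow, mul_one_div, div_le_div_iff₀ (by positivity) (by norm_num)]
      nlinarith [sq_nonneg (e : ℝ)]
    have h4 : 0 < ω 0 := hω.2.1
    have h5 : ω 0 ≤ 1 / 2 := hω.2.2
    nlinarith
  refine (lintegral_mono_set hcover).trans_lt ?_
  refine (lintegral_iUnion_le _ _).trans_lt ?_
  rw [tsum_fintype]
  refine ENNReal.sum_lt_top.2 fun p _ => ?_
  set s : ℝ := if p.2 then 1 else -1 with hs
  have hs1 : |s| = 1 := by rw [hs]; split_ifs <;> simp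
  set m : Fin (e + 2) := p.1.succ with hm
  have hm0 : m ≠ 0 := Fin.succ_ne_zero _
  obtain ⟨K, hK⟩ := chart_le (e + 1) m c s hc0 hs1 (P p) (fun ω hω => hω.1.1) (fun ω hω => hω.2)
  set π := fun (ω : EuclideanSpace ℝ (Fin (e + 2))) (k : Fin (e + 1)) => ω (m.succAbove k) with hπ
  have hπm : Measurable π := by fun_prop
  set μ := (Measure.hausdorffMeasure ((e + 1 : ℕ) : ℝ) :
    Measure (EuclideanSpace ℝ (Fin (e + 2)))).restrict (P p) with hμ
  have hae : ∀ᵐ ω ∂μ, ∀ k, π ω k ≠ 0 := by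
    have h1 : ∀ᵐ y : Fin (e + 1) → ℝ, ∀ k, y k ≠ 0 :=
      ae_all_iff.2 fun k => Measure.ae_eval_ne _ k 0
    have h2 : ∀ᵐ y ∂(Measure.map π μ), ∀ k, y k ≠ 0 :=
      (Measure.absolutelyContinuous_of_le_smul hK).ae_le h1
    exact ae_of_ae_map hπm.aemeasurable h2
  refine (lintegral_mono_ae (g := fun ω => ENNReal.ofReal (Real.exp (-Real.log c)) ^ (e + 1) *
        ∑ i, WW e b i (π ω)) ?_).trans_lt ?_
  · filter_upwards [hae, ae_restrict_mem (hPm p)] with ω hω hωP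
    have hcm : c ≤ |ω m| := by
      have h1 : c ≤ s * ω m := hωP.2
      calc c ≤ |s * ω m| := h1.trans (le_abs_self _)
        _ = |ω m| := by rw [abs_mul, hs1, one_mul]
    refine pointwise_bound e α γ hα hγ0 hγ' j b hb hb1 hj ω (hsq ω hωP.1) hωP.1.2.1 hωP.1.2.2
      ?_ m hm0 c hc0 hc1 hcm
    intro k
    rcases eq_or_ne k m with rfl | hk
    · intro h
      rw [h, abs_zero] at hcm
      linarith
    · obtain ⟨k', rfl⟩ := Fin.exists_succAbove_eq hk
      exact hω k'
  have hWm : Measurable fun y : Fin (e + 1) → ℝ => ∑ i, WW e b i y :=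
    Finset.measurable_sum _ fun i _ => WW_meas e b i
  rw [lintegral_const_mul (f := fun ω => ∑ i, WW e b i (π ω)) _ (hWm.comp hπm)]
  refine ENNReal.mul_lt_top (ENNReal.pow_lt_top ENNReal.ofReal_lt_top) ?_
  rw [← lintegral_map (f := fun y => ∑ i, WW e b i y) hWm hπm]
  refine (lintegral_mono' hK le_rfl).trans_lt ?_
  rw [lintegral_smul_measure, lintegral_finsetSum _ fun i _ => WW_meas e b i, smul_eq_mul]
  refine ENNReal.mul_lt_top ?_ (ENNReal.sum_lt_top.2 fun i _ => WW_int e hb i)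
  exact ENNReal.rpow_lt_top_of_nonneg (by positivity) ENNReal.coe_ne_top
end
end

section
/- Improved Hardy inequality on a ball touching the origin (Remark 8.2(1)): let n ≥ 2, R > 0, let x₀ ∈ ℝⁿ with |x₀| = R, and let B := B(x₀, R) be the open ball of radius R centered at x₀ (so that 0 ∈ ∂B and δ_B(x) = R − |x − x₀| for x ∈ B). Then for every φ ∈ C_c^∞(B): ∫_B |∇φ(x)|² dx − (1/4) ∫_B φ(x)²/δ_B(x)² dx ≥ ((n−1)²/4) ∫_B φ(x)²/|x|² dx. -/
open MeasureTheory

noncomputable section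

theorem hardy_integrable_aux {n : ℕ} {φ : EuclideanSpace ℝ (Fin n) → ℝ}
    (hc : HasCompactSupport φ) (h : EuclideanSpace ℝ (Fin n) → ℝ)
    (h1 : ContinuousOn h (tsupport φ)) (h2 : ∀ x, x ∉ tsupport φ → h x = 0) :
    Integrable h := by
  have := h1.integrableOn_compact (μ := volume) hc
  exact this.integrable_of_forall_notMem_eq_zero h2

theorem hardy_div_aux {n : ℕ} {φ : EuclideanSpace ℝ (Fin n) → ℝ}
    (hd : ContDiff ℝ (⊤ : ℕ∞) φ)
    (hc : HasCompactSupport φ) (b : EuclideanSpace ℝ (Fin n)) (s t : ℝ)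
    (hN : ∀ x ∈ tsupport φ, s + t * ‖x - b‖ ^ 2 ≠ 0) :
    Integrable (fun x => φ x ^ 2 * (n * (s + t * ‖x - b‖ ^ 2)⁻¹
        - 2 * t * ‖x - b‖ ^ 2 * ((s + t * ‖x - b‖ ^ 2)⁻¹) ^ 2)
        + 2 * φ x * (s + t * ‖x - b‖ ^ 2)⁻¹ * fderiv ℝ φ x (x - b)) ∧
    ∫ x, (φ x ^ 2 * (n * (s + t * ‖x - b‖ ^ 2)⁻¹
        - 2 * t * ‖x - b‖ ^ 2 * ((s + t * ‖x - b‖ ^ 2)⁻¹) ^ 2)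
        + 2 * φ x * (s + t * ‖x - b‖ ^ 2)⁻¹ * fderiv ℝ φ x (x - b)) = 0 := by
  have hφc : Continuous φ := hd.continuous
  have hφ'c : Continuous (fderiv ℝ φ) := hd.continuous_fderiv (by simp)
  have hcinv : ContinuousOn (fun x => (s + t * ‖x - b‖ ^ 2)⁻¹) (tsupport φ) :=
    ContinuousOn.inv₀ (by fun_prop) hN
  have hz : ∀ x, x ∉ tsupport φ → φ x = 0 := fun x hx => image_eq_zero_of_notMem_tsupport hx
  let e : Fin n → EuclideanSpace ℝ (Fin n) := fun i => EuclideanSpace.single i 1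
  let g' : Fin n → EuclideanSpace ℝ (Fin n) → ℝ := fun i x =>
    (s + t * ‖x - b‖ ^ 2)⁻¹ - 2 * t * (x i - b i) ^ 2 * ((s + t * ‖x - b‖ ^ 2)⁻¹) ^ 2
  let g : Fin n → EuclideanSpace ℝ (Fin n) → ℝ := fun i x =>
    (s + t * ‖x - b‖ ^ 2)⁻¹ * (x i - b i)
  have I1 : ∀ i, Integrable (fun x => φ x ^ 2 * g' i x) := by
    intro i
    refine hardy_integrable_aux hc _ ?_ (fun x hx => by simp [hz x hx])
    simp only [g']
    fun_prop
  have I2 : ∀ i, Integrable (fun x => 2 * φ x * fderiv ℝ φ x (e i) * g i x) := by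
    intro i
    refine hardy_integrable_aux hc _ ?_ (fun x hx => by simp [hz x hx])
    simp only [g]
    fun_prop
  have I3 : ∀ i, Integrable (fun x => φ x ^ 2 * g i x) := by
    intro i
    refine hardy_integrable_aux hc _ ?_ (fun x hx => by simp [hz x hx])
    simp only [g]
    fun_prop
  have key : ∀ i, ∫ x, φ x ^ 2 * g' i x = - ∫ x, 2 * φ x * fderiv ℝ φ x (e i) * g i x := by
    intro i
    refine integral_bilinear_hasLineDerivAt_right_eq_neg_left_of_integrable (v := e i)
      (f := fun x => φ x ^ 2) (g := g i) (g' := g' i)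
      (f' := fun x => 2 * φ x * fderiv ℝ φ x (e i))
      (B := ContinuousLinearMap.mul ℝ ℝ) (I2 i) (I1 i) (I3 i) ?_ ?_
    · intro x _
      have h := (hd.differentiable (by simp) x).hasFDerivAt.hasLineDerivAt (e i)
      unfold HasLineDerivAt at h ⊢
      have h2 := h.pow 2
      convert! h2 using 1
      simp
    · intro x hx
      have hx' : x ∈ tsupport φ := by
        refine closure_mono ?_ hx
        intro y hy
        simpa using hy
      have hne := hN x hx'
      have h1 : HasLineDerivAt ℝ (fun y : EuclideanSpace ℝ (Fin n) => ‖y - b‖ ^ 2)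
          (2 * (x i - b i)) x (e i) := by
        have h := ((hasFDerivAt_id x).sub_const b).norm_sq.hasLineDerivAt (e i)
        convert! h using 1
        simp [e, EuclideanSpace.inner_single_right]
      have h2 : HasLineDerivAt ℝ (fun y : EuclideanSpace ℝ (Fin n) => y i - b i)
          1 x (e i) := by
        unfold HasLineDerivAt
        have : HasDerivAt (fun r : ℝ => (x i + r * 1) - b i) (1 * 1) 0 :=
          (((hasDerivAt_id (0:ℝ)).mul_const 1).const_add (x i)).sub_const (b i)
        simpa [e] using this
      unfold HasLineDerivAt at h1 h2 ⊢
      have h3 := (((h1.const_mul t).const_add s).inv (by simpa using hne)).mul h2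
      convert! h3 using 1
      simp [g']
      field_simp
      ring
  have hsum : ∀ x, (φ x ^ 2 * (n * (s + t * ‖x - b‖ ^ 2)⁻¹
        - 2 * t * ‖x - b‖ ^ 2 * ((s + t * ‖x - b‖ ^ 2)⁻¹) ^ 2)
        + 2 * φ x * (s + t * ‖x - b‖ ^ 2)⁻¹ * fderiv ℝ φ x (x - b)) =
      ∑ i, (φ x ^ 2 * g' i x + 2 * φ x * fderiv ℝ φ x (e i) * g i x) := by
    intro x
    have e1 : ‖x - b‖ ^ 2 = ∑ i, (x i - b i) ^ 2 := by
      rw [EuclideanSpace.norm_sq_eq]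
      simp
    have e2 : fderiv ℝ φ x (x - b) = ∑ i, (x i - b i) * fderiv ℝ φ x (e i) := by
      have : x - b = ∑ i, (x i - b i) • e i := by
        ext j
        simp [e, Finset.sum_apply, Pi.single_apply]
      conv_lhs => rw [this]
      simp [map_sum]
    generalize hC : (s + t * ‖x - b‖ ^ 2)⁻¹ = C
    simp only [g', g, hC]
    rw [e1, e2, Finset.sum_add_distrib, ← Finset.mul_sum, Finset.sum_sub_distrib,
      ← Finset.sum_mul, ← Finset.mul_sum, Finset.mul_sum (a := 2 * φ x * C)]
    simp only [Finset.sum_const, Finset.card_univ, Fintype.card_fin, nsmul_eq_mul]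
    congr 1
    exact Finset.sum_congr rfl fun i _ => by ring
  simp_rw [hsum]
  have I4 : ∀ i, Integrable
      (fun x => φ x ^ 2 * g' i x + 2 * φ x * fderiv ℝ φ x (e i) * g i x) :=
    fun i => (I1 i).add (I2 i)
  refine ⟨integrable_finsetSum _ fun i _ => I4 i, ?_⟩
  rw [integral_finsetSum _ fun i _ => I4 i]
  refine Finset.sum_eq_zero fun i _ => ?_
  rw [integral_add (I1 i) (I2 i), key i]
  simp

theorem hardy_scalar_aux (a A B q : ℝ) (hA : 0 < A) (hB : 0 < B) (hq : 0 < q) :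
    ((2 * a + 1) * q⁻¹ + 2 * ((A + B - 2 * q) / 4) * (q⁻¹) ^ 2)
      + a * ((2 * a + 1) * A⁻¹ - 2 * A * (A⁻¹) ^ 2)
      + a * ((2 * a + 1) * B⁻¹ - 2 * B * (B⁻¹) ^ 2)
      - ((a * A⁻¹ + q⁻¹ / 2) ^ 2 * A + (a * B⁻¹ + q⁻¹ / 2) ^ 2 * B
        - 2 * (a * A⁻¹ + q⁻¹ / 2) * (a * B⁻¹ + q⁻¹ / 2) * q)
      = (A + B + 2 * q) / 4 / q ^ 2 + a ^ 2 * (A + B + 2 * q) / (A * B) := by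
  field_simp
  ring

set_option maxHeartbeats 1600000 in
theorem hardy_pointwise_aux {E : Type*} [NormedAddCommGroup E] [InnerProductSpace ℝ E]
    (v x x₀ : E) (f a R : ℝ) (hR : 0 < R) (hx₀ : ‖x₀‖ = R) (hx : ‖x - x₀‖ < R) :
    a ^ 2 * (f ^ 2 / ‖x‖ ^ 2) + 1 / 4 * (f ^ 2 / (R - ‖x - x₀‖) ^ 2) ≤
      ‖v‖ ^ 2 +
      (f ^ 2 * ((2 * a + 1) * (R ^ 2 + (-1) * ‖x - x₀‖ ^ 2)⁻¹
        - 2 * (-1) * ‖x - x₀‖ ^ 2 * ((R ^ 2 + (-1) * ‖x - x₀‖ ^ 2)⁻¹) ^ 2)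
        + 2 * f * (R ^ 2 + (-1) * ‖x - x₀‖ ^ 2)⁻¹ * inner ℝ v (x - x₀))
      + a * (f ^ 2 * ((2 * a + 1) * (0 + 1 * ‖x - 0‖ ^ 2)⁻¹
        - 2 * 1 * ‖x - 0‖ ^ 2 * ((0 + 1 * ‖x - 0‖ ^ 2)⁻¹) ^ 2)
        + 2 * f * (0 + 1 * ‖x - 0‖ ^ 2)⁻¹ * inner ℝ v (x - 0))
      + a * (f ^ 2 * ((2 * a + 1) * (0 + 1 * ‖x - (2 : ℝ) • x₀‖ ^ 2)⁻¹
        - 2 * 1 * ‖x - (2 : ℝ) • x₀‖ ^ 2 * ((0 + 1 * ‖x - (2 : ℝ) • x₀‖ ^ 2)⁻¹) ^ 2)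
        + 2 * f * (0 + 1 * ‖x - (2 : ℝ) • x₀‖ ^ 2)⁻¹ * inner ℝ v (x - (2 : ℝ) • x₀)) := by
  obtain ⟨y, hy⟩ : ∃ y, y = x - (2 : ℝ) • x₀ := ⟨_, rfl⟩
  have hz : x - x₀ = (1 / 2 : ℝ) • (x + y) := by rw [hy]; module
  have hx0 : x₀ = (1 / 2 : ℝ) • (x - y) := by rw [hy]; module
  have nz : ‖x - x₀‖ ^ 2 = (‖x‖ ^ 2 + 2 * inner ℝ x y + ‖y‖ ^ 2) / 4 := by
    rw [hz, norm_smul, mul_pow, norm_add_sq_real]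
    norm_num
    ring
  have nx0 : R ^ 2 = (‖x‖ ^ 2 - 2 * inner ℝ x y + ‖y‖ ^ 2) / 4 := by
    rw [← hx₀, hx0, norm_smul, mul_pow, norm_sub_sq_real]
    norm_num
    ring
  have iz : inner ℝ v (x - x₀) = (inner ℝ v x + inner ℝ v y) / 2 := by
    rw [hz, inner_smul_right, inner_add_right]; ring
  obtain ⟨q, hqdef⟩ : ∃ q : ℝ, q = - inner ℝ x y := ⟨_, rfl⟩
  have hq' : R ^ 2 + (-1) * ‖x - x₀‖ ^ 2 = q := by rw [nz, nx0, hqdef]; ring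
  have hr0 := norm_nonneg (x - x₀)
  have hq : 0 < q := by rw [← hq']; nlinarith
  have hxpos : 0 < ‖x‖ := by
    rw [norm_pos_iff]; rintro rfl; simp at hqdef; linarith
  have hypos : 0 < ‖y‖ := by
    rw [norm_pos_iff]; rintro h; rw [h] at hqdef; simp at hqdef; linarith
  have hA : 0 < ‖x‖ ^ 2 := by positivity
  have hB : 0 < ‖y‖ ^ 2 := by positivity
  have hyle : ‖y‖ ^ 2 ≤ 4 * R ^ 2 := by
    have : ‖y‖ ≤ 2 * R := by
      have h1 : y = (x - x₀) - x₀ := by rw [hy]; module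
      have := norm_sub_le (x - x₀) x₀
      rw [← h1] at this
      linarith
    nlinarith
  have hsq : 0 ≤ ‖v + f • ((a * (‖x‖ ^ 2)⁻¹ + q⁻¹ / 2) • x
      + (a * (‖y‖ ^ 2)⁻¹ + q⁻¹ / 2) • y)‖ ^ 2 := by positivity
  have hexp : ‖v + f • ((a * (‖x‖ ^ 2)⁻¹ + q⁻¹ / 2) • x
      + (a * (‖y‖ ^ 2)⁻¹ + q⁻¹ / 2) • y)‖ ^ 2 = ‖v‖ ^ 2
      + 2 * f * ((a * (‖x‖ ^ 2)⁻¹ + q⁻¹ / 2) * inner ℝ v x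
        + (a * (‖y‖ ^ 2)⁻¹ + q⁻¹ / 2) * inner ℝ v y)
      + f ^ 2 * ((a * (‖x‖ ^ 2)⁻¹ + q⁻¹ / 2) ^ 2 * ‖x‖ ^ 2
        + (a * (‖y‖ ^ 2)⁻¹ + q⁻¹ / 2) ^ 2 * ‖y‖ ^ 2
        - 2 * (a * (‖x‖ ^ 2)⁻¹ + q⁻¹ / 2) * (a * (‖y‖ ^ 2)⁻¹ + q⁻¹ / 2) * q) := by
    generalize a * (‖x‖ ^ 2)⁻¹ + q⁻¹ / 2 = α
    generalize a * (‖y‖ ^ 2)⁻¹ + q⁻¹ / 2 = β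
    rw [norm_add_sq_real, norm_smul, mul_pow, norm_add_sq_real, hqdef]
    simp only [inner_smul_right, inner_smul_left, inner_add_right, norm_smul, mul_pow,
      Real.norm_eq_abs, sq_abs]
    simp
    ring
  have hs := hardy_scalar_aux a (‖x‖ ^ 2) (‖y‖ ^ 2) q hA hB hq
  have h4 : ‖x‖ ^ 2 + ‖y‖ ^ 2 + 2 * q = 4 * R ^ 2 := by rw [nx0, hqdef]; ring
  have hb1 : a ^ 2 / ‖x‖ ^ 2 ≤ a ^ 2 * (4 * R ^ 2) / (‖x‖ ^ 2 * ‖y‖ ^ 2) := by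
    rw [div_le_div_iff₀ hA (by positivity)]
    have : 0 ≤ a ^ 2 * ‖x‖ ^ 2 * (4 * R ^ 2 - ‖y‖ ^ 2) :=
      mul_nonneg (by positivity) (by linarith)
    nlinarith
  have hb2 : 1 / 4 / (R - ‖x - x₀‖) ^ 2 ≤ 4 * R ^ 2 / 4 / q ^ 2 := by
    have hd : 0 < R - ‖x - x₀‖ := by linarith
    rw [div_le_div_iff₀ (by positivity) (by positivity)]
    have : q ≤ 2 * R * (R - ‖x - x₀‖) := by rw [← hq']; nlinarith
    have h5 : q ^ 2 ≤ (2 * R * (R - ‖x - x₀‖)) ^ 2 := pow_le_pow_left₀ hq.le this 2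
    have h6 : (2 * R * (R - ‖x - x₀‖)) ^ 2 = 4 * (4 * R ^ 2 / 4 * (R - ‖x - x₀‖) ^ 2) := by
      ring
    rw [h6] at h5
    linarith
  rw [hexp] at hsq
  rw [h4] at hs
  have hmain := mul_le_mul_of_nonneg_left (add_le_add hb2 hb1) (sq_nonneg f)
  rw [← hs] at hmain
  have nz' : ‖x - x₀‖ ^ 2 = (‖x‖ ^ 2 + ‖y‖ ^ 2 - 2 * q) / 4 := by rw [nz, hqdef]; ring
  rw [hq', iz, ← hy, sub_zero, nz']
  simp only [zero_add, one_mul]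
  have hl : a ^ 2 * (f ^ 2 / ‖x‖ ^ 2) + 1 / 4 * (f ^ 2 / (R - ‖x - x₀‖) ^ 2)
      = f ^ 2 * (1 / 4 / (R - ‖x - x₀‖) ^ 2 + a ^ 2 / ‖x‖ ^ 2) := by ring
  rw [hl]
  refine hmain.trans ?_
  rw [← sub_nonneg]
  refine hsq.trans (le_of_eq ?_)
  ring

/-- Improved Hardy inequality on a ball touching the origin: for the ball
`B = B(x₀, R)` with `|x₀| = R` (so `0 ∈ ∂B`), one has
`∫_B |∇φ|² - (1/4)∫_B φ²/δ_B² ≥ ((n-1)²/4) ∫_B φ²/|x|²` for all test functions. -/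
theorem hardy_ball_touching_origin {n : ℕ} (hn : 2 ≤ n) (R : ℝ) (hR : 0 < R)
    (x₀ : EuclideanSpace ℝ (Fin n)) (hx₀ : ‖x₀‖ = R) :
    ∀ φ : EuclideanSpace ℝ (Fin n) → ℝ, IsTestFun (Metric.ball x₀ R) φ →
      (((n : ℝ) - 1) ^ 2 / 4) * ∫ x in Metric.ball x₀ R, (φ x) ^ 2 / ‖x‖ ^ 2 ≤
        (∫ x in Metric.ball x₀ R, ‖gradient φ x‖ ^ 2)
          - (1 / 4) * ∫ x in Metric.ball x₀ R, (φ x) ^ 2 / (R - ‖x - x₀‖) ^ 2 := by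
  rintro φ ⟨hd, hc, hsub⟩
  have hφc : Continuous φ := hd.continuous
  have hφ'c : Continuous (fderiv ℝ φ) := hd.continuous_fderiv (by simp)
  have hz : ∀ x, x ∉ tsupport φ → φ x = 0 := fun x hx => image_eq_zero_of_notMem_tsupport hx
  have hz' : ∀ x, x ∉ tsupport φ → fderiv ℝ φ x = 0 := fun x hx => by
    by_contra h
    exact hx (support_fderiv_subset ℝ h)
  have hgn : ∀ x, ‖gradient φ x‖ = ‖fderiv ℝ φ x‖ := fun x => by simp [gradient]
  have hgi : ∀ x w, fderiv ℝ φ x w = inner ℝ (gradient φ x) w := fun x w => by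
    simp [gradient, InnerProductSpace.toDual_symm_apply]
  have hball : ∀ x ∈ tsupport φ, ‖x - x₀‖ < R := fun x hx => by
    simpa [dist_eq_norm] using hsub hx
  have hx1 : ∀ x ∈ tsupport φ, x ≠ 0 := by
    rintro x hx rfl
    have := hball _ hx
    simp [hx₀] at this
  have hx2 : ∀ x ∈ tsupport φ, x - (2 : ℝ) • x₀ ≠ 0 := by
    intro x hx h
    have h1 := hball _ hx
    have : x - x₀ = x₀ := by
      have : x - x₀ = (x - (2 : ℝ) • x₀) + x₀ := by module
      rw [this, h, zero_add]
    rw [this, hx₀] at h1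
    exact lt_irrefl _ h1
  have J1 : Integrable (fun x => φ x ^ 2 / ‖x‖ ^ 2) := by
    refine hardy_integrable_aux hc _ ?_ (fun x hx => by simp [hz x hx])
    exact ContinuousOn.div (by fun_prop) (by fun_prop) fun x hx => by simpa using hx1 x hx
  have J2 : Integrable (fun x => φ x ^ 2 / (R - ‖x - x₀‖) ^ 2) := by
    refine hardy_integrable_aux hc _ ?_ (fun x hx => by simp [hz x hx])
    exact ContinuousOn.div (by fun_prop) (by fun_prop) fun x hx => by
      have := hball x hx
      have : 0 < R - ‖x - x₀‖ := by linarith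
      positivity
  have J3 : Integrable (fun x => ‖gradient φ x‖ ^ 2) := by
    simp only [hgn]
    refine hardy_integrable_aux hc _ ?_ (fun x hx => by simp [hz' x hx])
    fun_prop
  have r1 : ∫ x in Metric.ball x₀ R, (φ x) ^ 2 / ‖x‖ ^ 2 = ∫ x, (φ x) ^ 2 / ‖x‖ ^ 2 :=
    setIntegral_eq_integral_of_forall_compl_eq_zero fun x hx => by
      simp [hz x fun h => hx (hsub h)]
  have r2 : ∫ x in Metric.ball x₀ R, (φ x) ^ 2 / (R - ‖x - x₀‖) ^ 2
      = ∫ x, (φ x) ^ 2 / (R - ‖x - x₀‖) ^ 2 :=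
    setIntegral_eq_integral_of_forall_compl_eq_zero fun x hx => by
      simp [hz x fun h => hx (hsub h)]
  have r3 : ∫ x in Metric.ball x₀ R, ‖gradient φ x‖ ^ 2 = ∫ x, ‖gradient φ x‖ ^ 2 :=
    setIntegral_eq_integral_of_forall_compl_eq_zero fun x hx => by
      simp [hgn, hz' x fun h => hx (hsub h)]
  rw [r1, r2, r3]
  obtain ⟨a, ha⟩ : ∃ a : ℝ, a = ((n : ℝ) - 1) / 2 := ⟨_, rfl⟩
  have hna : (n : ℝ) = 2 * a + 1 := by rw [ha]; ring
  have hca : ((n : ℝ) - 1) ^ 2 / 4 = a ^ 2 := by rw [ha]; ring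
  obtain ⟨K1, L1⟩ := hardy_div_aux hd hc x₀ (R ^ 2) (-1) (fun x hx => by
    have := hball x hx
    have := norm_nonneg (x - x₀)
    nlinarith)
  obtain ⟨K2, L2⟩ := hardy_div_aux hd hc 0 0 1 (fun x hx => by simpa using hx1 x hx)
  obtain ⟨K3, L3⟩ := hardy_div_aux hd hc ((2 : ℝ) • x₀) 0 1 (fun x hx => by
    simpa using hx2 x hx)
  have hle := integral_mono ((J1.const_mul (a ^ 2)).add (J2.const_mul (1 / 4)))
    (((J3.add K1).add (K2.const_mul a)).add (K3.const_mul a)) (fun x => by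
      by_cases hx : x ∈ tsupport φ
      · have := hardy_pointwise_aux (gradient φ x) x x₀ (φ x) a R hR hx₀ (hball x hx)
        simp only [Pi.add_apply, hgi, hna]
        exact this
      · simp [hz x hx])
  rw [integral_add' (J1.const_mul (a ^ 2)) (J2.const_mul (1 / 4)),
    integral_add' ((J3.add K1).add (K2.const_mul a)) (K3.const_mul a),
    integral_add' (J3.add K1) (K2.const_mul a), integral_add' J3 K1,
    integral_const_mul, integral_const_mul, integral_const_mul, integral_const_mul,
    L1, L2, L3] at hle
  rw [hca]
  linarith
end
end
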